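/- arXiv:2101.03596 — 10 statements merged into one kernel-verified Lean document; each statement's English description precedes it below -/
import Mathlib

section
/- Let U be an open subset of ℂ and let f : ℂ → ℂ be continuous on U. If f is complex-differentiable at every point of U \ {z ∈ U : f z = 0} (i.e., f is holomorphic on the complement in U of its zero set), then f is holomorphic on all of U (DifferentiableOn ℂ f U). -/
open Complex Metric Set Real in
/-- The maximum principle for `g` only needs to be checked off the zeros of another holomorphic
function `f` on the frontier. -/
theorem DiffContOnCl.norm_le_one_of_forall_mem_frontier {f g : ℂ → ℂ} {Ω : Set ℂ}
    (hΩ : Bornology.IsBounded Ω) (hf : DiffContOnCl ℂ f Ω) (hg : DiffContOnCl ℂ g Ω)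
    (h : ∀ z ∈ frontier Ω, f z = 0 ∨ ‖g z‖ ≤ 1) {a : ℂ} (ha : a ∈ Ω) (hfa : f a ≠ 0) :
    ‖g a‖ ≤ 1 := by
  have hcomp : IsCompact (frontier Ω) :=
    hΩ.isCompact_closure.of_isClosed_subset isClosed_frontier frontier_subset_closure
  obtain ⟨M, hM⟩ := hcomp.exists_bound_of_continuousOn (hf.2.mono frontier_subset_closure)
  have hpow : ∀ n : ℕ, DiffContOnCl ℂ (fun z ↦ g z ^ n) Ω := fun n ↦
    ⟨hg.1.pow n, hg.2.pow n⟩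
  have key : ∀ n : ℕ, ‖f a‖ * ‖g a‖ ^ n ≤ max M 0 := by
    intro n
    have := norm_le_of_forall_mem_frontier_norm_le hΩ (hf.smul (hpow n)) (C := max M 0)
      (fun z hz ↦ ?_) (subset_closure ha)
    · simpa using this
    rcases h z hz with h0 | h1
    · simp [h0]
    · calc ‖f z • g z ^ n‖ = ‖f z‖ * ‖g z‖ ^ n := by simp
        _ ≤ ‖f z‖ * 1 := by gcongr; exact pow_le_one₀ (norm_nonneg _) h1
        _ ≤ max M 0 := by rw [mul_one]; exact (hM z hz).trans (le_max_left _ _)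
  by_contra! hlt
  obtain ⟨n, hn⟩ := pow_unbounded_of_one_lt (max M 0 / ‖f a‖) hlt
  rw [div_lt_iff₀' (norm_pos_iff.2 hfa)] at hn
  exact (key n).not_gt hn

open Polynomial Real in
/-- Real parts of polynomials are uniformly dense in the real continuous functions on the unit
circle. -/
theorem exists_polynomial_abs_re_eval_sub_lt {u : ℂ → ℝ}
    (hu : ContinuousOn u (Metric.sphere 0 1)) {ε : ℝ} (hε : 0 < ε) :
    ∃ P : ℂ[X], ∀ z ∈ Metric.sphere (0 : ℂ) 1, |(P.eval z).re - u z| < ε := by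
  have hcont : Continuous fun x : AddCircle (1 : ℝ) ↦ (u (AddCircle.toCircle x) : ℂ) := by
    refine Complex.continuous_ofReal.comp (hu.comp_continuous ?_ fun x ↦ by
      rw [mem_sphere_zero_iff_norm, Circle.norm_coe])
    exact continuous_subtype_val.comp AddCircle.continuous_toCircle
  have hspan : ∀ g ∈ Submodule.span ℂ (Set.range (@fourier 1)), ∃ P Q : ℂ[X],
      ∀ x : AddCircle (1 : ℝ), g x = P.eval (AddCircle.toCircle x : ℂ) +
        (starRingEnd ℂ) (Q.eval (AddCircle.toCircle x : ℂ)) := by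
    intro g hg
    induction hg using Submodule.span_induction with
    | mem g hg =>
      obtain ⟨n, rfl⟩ := hg
      obtain ⟨m, rfl | rfl⟩ := n.eq_nat_or_neg
      · exact ⟨X ^ m, 0, fun x ↦ by simp [fourier_apply, AddCircle.toCircle_nsmul]⟩
      · exact ⟨0, X ^ m, fun x ↦ by
          simp [fourier_apply, AddCircle.toCircle_nsmul, AddCircle.toCircle_neg,
            ← Circle.coe_inv_eq_conj]⟩
    | zero => exact ⟨0, 0, fun x ↦ by simp⟩
    | add g₁ g₂ _ _ h₁ h₂ =>
      obtain ⟨P₁, Q₁, h₁⟩ := h₁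
      obtain ⟨P₂, Q₂, h₂⟩ := h₂
      exact ⟨P₁ + P₂, Q₁ + Q₂, fun x ↦ by simp [h₁, h₂]; ring⟩
    | smul c g _ h =>
      obtain ⟨P, Q, h⟩ := h
      exact ⟨C c * P, C ((starRingEnd ℂ) c) * Q, fun x ↦ by simp [h]; ring⟩
  have hmem : (⟨_, hcont⟩ : C(AddCircle (1 : ℝ), ℂ)) ∈
      (Submodule.span ℂ (Set.range (@fourier 1))).topologicalClosure := by
    rw [span_fourier_closure_eq_top]; trivial
  obtain ⟨g, hg, hdist⟩ := Metric.mem_closure_iff.1 hmem ε hε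
  obtain ⟨P, Q, hPQ⟩ := hspan g hg
  refine ⟨P + Q, fun z hz ↦ ?_⟩
  obtain ⟨x, hx⟩ := (AddCircle.homeomorphCircle (one_ne_zero (α := ℝ))).surjective
    ⟨z, by simpa [Submonoid.unitSphere] using hz⟩
  have hxz : (AddCircle.toCircle x : ℂ) = z := by
    rw [← AddCircle.homeomorphCircle_apply one_ne_zero, hx]
  have hgx := (ContinuousMap.dist_apply_le_dist x).trans_lt hdist
  rw [dist_comm, dist_eq_norm] at hgx
  have := (Complex.abs_re_le_norm _).trans_lt hgx
  simpa [hPQ, hxz] using this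

/-- A holomorphic function with locally constant real part has vanishing derivative. -/
theorem DifferentiableAt.deriv_eq_zero_of_re_eventuallyEq {g : ℂ → ℂ} {a : ℂ} {c : ℝ}
    (hg : DifferentiableAt ℂ g a) (h : (fun z ↦ (g z).re) =ᶠ[nhds a] fun _ ↦ c) :
    deriv g a = 0 := by
  have h₁ := Complex.reCLM.hasFDerivAt.comp a (hg.hasDerivAt.hasFDerivAt.restrictScalars ℝ)
  have h₂ : HasFDerivAt (fun z ↦ (g z).re) (0 : ℂ →L[ℝ] ℝ) a :=
    (hasFDerivAt_const c a).congr_of_eventuallyEq h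
  have h₃ := HasFDerivAt.unique h₁ h₂
  have h_one := DFunLike.congr_fun h₃ 1
  have h_I := DFunLike.congr_fun h₃ Complex.I
  apply Complex.ext
  · simpa using h_one
  · simpa using h_I

section UnitDisc

open Complex Metric Set Real

theorem isOpen_ball_inter_ne_zero {f : ℂ → ℂ} (hf : ContinuousOn f (closedBall 0 1)) :
    IsOpen (ball (0 : ℂ) 1 ∩ {z | f z ≠ 0}) :=
  (hf.mono ball_subset_closedBall).isOpen_inter_preimage isOpen_ball isOpen_ne

/-- The zero set of `f` may be ignored in the maximum principle on the unit disc. -/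
theorem norm_le_one_of_ne_zero {f : ℂ → ℂ} (hf : ContinuousOn f (closedBall 0 1))
    (hd : ∀ z ∈ ball (0 : ℂ) 1, f z ≠ 0 → DifferentiableAt ℂ f z)
    {g : ℂ → ℂ} (hg : DiffContOnCl ℂ g (ball (0 : ℂ) 1 ∩ {z | f z ≠ 0}))
    (h : ∀ z ∈ sphere (0 : ℂ) 1, ‖g z‖ ≤ 1) {a : ℂ} (ha : a ∈ ball (0 : ℂ) 1) (hfa : f a ≠ 0) :
    ‖g a‖ ≤ 1 := by
  have hcl : closure (ball (0 : ℂ) 1 ∩ {z | f z ≠ 0}) ⊆ closedBall 0 1 :=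
    closure_minimal (inter_subset_left.trans ball_subset_closedBall) isClosed_closedBall
  refine DiffContOnCl.norm_le_one_of_forall_mem_frontier (Ω := ball (0 : ℂ) 1 ∩ {z | f z ≠ 0})
    (isBounded_ball.subset inter_subset_left)
    ⟨fun z hz ↦ (hd z hz.1 hz.2).differentiableWithinAt, hf.mono hcl⟩ hg (fun z hz ↦ ?_)
    ⟨ha, hfa⟩ hfa
  by_contra hcon
  rw [not_or, not_le] at hcon
  rw [(isOpen_ball_inter_ne_zero hf).frontier_eq] at hz
  rcases (mem_closedBall.1 (hcl hz.1)).lt_or_eq with hlt | heq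
  · exact hz.2 ⟨hlt, hcon.1⟩
  · exact (h z heq).not_gt hcon.2

theorem re_le_circleAverage {f : ℂ → ℂ} (hf : ContinuousOn f (closedBall 0 1))
    (hd : ∀ z ∈ ball (0 : ℂ) 1, f z ≠ 0 → DifferentiableAt ℂ f z)
    {a : ℂ} (ha : a ∈ ball (0 : ℂ) 1) (hfa : f a ≠ 0) :
    (f a).re ≤ circleAverage ((re ∘ herglotzRieszKernel 0 a) • fun z ↦ (f z).re) 0 1 := by
  have hcl : closure (ball (0 : ℂ) 1 ∩ {z | f z ≠ 0}) ⊆ closedBall 0 1 :=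
    closure_minimal (inter_subset_left.trans ball_subset_closedBall) isClosed_closedBall
  have hre : ContinuousOn (fun z ↦ (f z).re) (sphere 0 1) :=
    continuous_re.comp_continuousOn (hf.mono sphere_subset_closedBall)
  have hker : ContinuousOn (re ∘ herglotzRieszKernel 0 a) (sphere 0 1) := by
    simpa using continuous_re.comp_continuousOn (continuousOn_herglotzRieszKernel_sphere ha)
  refine le_of_forall_pos_le_add fun ε hε ↦ ?_
  obtain ⟨P, hP⟩ := exists_polynomial_abs_re_eval_sub_lt hre (half_pos hε)
  have hle : (f a).re ≤ (P.eval a).re + ε / 2 := by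
    have hg : DiffContOnCl ℂ (fun z ↦ exp (f z - P.eval z - (ε / 2 : ℝ)))
        (ball (0 : ℂ) 1 ∩ {z | f z ≠ 0}) :=
      ⟨fun z hz ↦ (((hd z hz.1 hz.2).sub P.differentiable.differentiableAt).sub_const
          _).cexp.differentiableWithinAt,
        (((hf.mono hcl).sub P.continuous.continuousOn).sub continuousOn_const).cexp⟩
    have := norm_le_one_of_ne_zero hf hd hg (fun z hz ↦ ?_) ha hfa
    · rw [norm_exp, exp_le_one_iff] at this
      simp only [sub_re, ofReal_re] at this
      linarith
    · rw [norm_exp, exp_le_one_iff]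
      simp only [sub_re, ofReal_re]
      linarith [(abs_lt.1 (hP z hz)).1]
  have hpoisson : circleAverage ((re ∘ herglotzRieszKernel 0 a) • fun z ↦ (P.eval z).re - ε / 2)
      0 1 = (P.eval a).re - ε / 2 := by
    have hPd : DiffContOnCl ℂ (fun z ↦ P.eval z - (ε / 2 : ℝ)) (ball 0 1) :=
      (P.differentiable.sub_const _).diffContOnCl
    have hint : CircleIntegrable ((re ∘ herglotzRieszKernel 0 a) •
        fun z ↦ P.eval z - (ε / 2 : ℝ)) 0 1 :=
      ContinuousOn.circleIntegrable zero_le_one (hker.smul (by fun_prop))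
    have h₁ := reCLM.circleAverage_comp_comm hint
    rw [hPd.circleAverage_re_herglotzRieszKernel_smul ha] at h₁
    convert h₁ using 1
    · congr 1
      ext z
      simp
    · simp
  have hmono : circleAverage ((re ∘ herglotzRieszKernel 0 a) • fun z ↦ (P.eval z).re - ε / 2)
      0 1 ≤ circleAverage ((re ∘ herglotzRieszKernel 0 a) • fun z ↦ (f z).re) 0 1 := by
    refine circleAverage_mono
      (ContinuousOn.circleIntegrable zero_le_one (hker.smul (by fun_prop)))
      (ContinuousOn.circleIntegrable zero_le_one (hker.smul hre)) fun z hz ↦ ?_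
    rw [abs_one] at hz
    have hpos : 0 ≤ (herglotzRieszKernel 0 a z).re := by
      refine le_trans ?_ (le_re_herglotzRieszKernel hz ha)
      have : ‖a‖ < 1 := by simpa using ha
      rw [sub_zero]
      exact div_nonneg (by linarith) (by positivity)
    simp only [Pi.smul_apply', Function.comp_apply, smul_eq_mul]
    gcongr
    linarith [(abs_lt.1 (hP z hz)).2]
  linarith

theorem re_eq_circleAverage {f : ℂ → ℂ} (hf : ContinuousOn f (closedBall 0 1))
    (hd : ∀ z ∈ ball (0 : ℂ) 1, f z ≠ 0 → DifferentiableAt ℂ f z)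
    {a : ℂ} (ha : a ∈ ball (0 : ℂ) 1) (hfa : f a ≠ 0) :
    (f a).re = circleAverage ((re ∘ herglotzRieszKernel 0 a) • fun z ↦ (f z).re) 0 1 := by
  refine (re_le_circleAverage hf hd ha hfa).antisymm ?_
  have := re_le_circleAverage (f := fun z ↦ -f z) hf.neg
    (fun z hz h ↦ (hd z hz (neg_ne_zero.1 h)).neg) ha (neg_ne_zero.2 hfa)
  have hneg : ((re ∘ herglotzRieszKernel 0 a) • fun z ↦ (-f z).re) =
      (-1 : ℝ) • ((re ∘ herglotzRieszKernel 0 a) • fun z ↦ (f z).re) := by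
    ext z
    simp
  rw [hneg, circleAverage_smul, neg_re, smul_eq_mul] at this
  linarith

/-- Off the zeros of `f`, the real part of `f` is the real part of a function analytic on the whole
disc. -/
theorem exists_analyticOnNhd_re_eq {f : ℂ → ℂ} (hf : ContinuousOn f (closedBall 0 1))
    (hd : ∀ z ∈ ball (0 : ℂ) 1, f z ≠ 0 → DifferentiableAt ℂ f z) :
    ∃ H : ℂ → ℂ, AnalyticOnNhd ℂ H (ball 0 1) ∧
      ∀ z ∈ ball (0 : ℂ) 1, f z ≠ 0 → (f z).re = (H z).re := by
  have hre : CircleIntegrable (fun z ↦ (f z).re) 0 1 :=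
    (continuous_re.comp_continuousOn
      (hf.mono sphere_subset_closedBall)).circleIntegrable zero_le_one
  have hreC : CircleIntegrable (fun z ↦ ((f z).re : ℂ)) 0 1 :=
    (continuous_ofReal.comp_continuousOn (continuous_re.comp_continuousOn
      (hf.mono sphere_subset_closedBall))).circleIntegrable zero_le_one
  refine ⟨_, analyticOnNhd_circleAverage_herglotzRieszKernel_smul
    hreC,
    fun z hz hfz ↦ ?_⟩
  rw [re_circleAverage_herglotzRieszKernel_smul hre hz, re_eq_circleAverage hf hd hz hfz]

theorem ball_subset_closure_ne_zero {f : ℂ → ℂ} (hf : ContinuousOn f (closedBall 0 1))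
    (hd : ∀ z ∈ ball (0 : ℂ) 1, f z ≠ 0 → DifferentiableAt ℂ f z)
    {α : ℂ} (hα : α ∈ ball (0 : ℂ) (1 / 4)) (hfα : f α ≠ 0) :
    ball (0 : ℂ) (1 / 4) ⊆ closure (ball (0 : ℂ) 1 ∩ {z | f z ≠ 0}) := by
  intro b hb
  by_contra hbc
  rw [mem_ball_zero_iff] at hα hb
  have hg : DiffContOnCl ℂ (fun z ↦ (1 / 2) / (z - b)) (ball (0 : ℂ) 1 ∩ {z | f z ≠ 0}) := by
    refine DifferentiableOn.diffContOnCl fun z hz ↦ ?_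
    have : z - b ≠ 0 := sub_ne_zero.2 fun h ↦ hbc (h ▸ hz)
    fun_prop (disch := assumption)
  have hαΩ : α ∈ ball (0 : ℂ) 1 := by rw [mem_ball_zero_iff]; linarith
  have h₁ := norm_le_one_of_ne_zero hf hd hg (fun z hz ↦ ?_) hαΩ hfα
  · have hαb : 0 < ‖α - b‖ :=
      norm_pos_iff.2 (sub_ne_zero.2 fun h ↦ hbc (h ▸ subset_closure ⟨hαΩ, hfα⟩))
    rw [norm_div, div_le_one hαb] at h₁
    norm_num at h₁
    linarith [norm_sub_le α b]
  · rw [mem_sphere_zero_iff_norm] at hz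
    have := norm_sub_norm_le z b
    rw [norm_div, div_le_one (by linarith)]
    norm_num
    linarith

theorem differentiableAt_zero_of_differentiableAt_ne_zero {f : ℂ → ℂ}
    (hf : ContinuousOn f (closedBall 0 1))
    (hd : ∀ z ∈ ball (0 : ℂ) 1, f z ≠ 0 → DifferentiableAt ℂ f z) :
    DifferentiableAt ℂ f 0 := by
  have hnhds : ball (0 : ℂ) (1 / 4) ∈ nhds 0 := ball_mem_nhds _ (by norm_num)
  by_cases hzero : ∀ z ∈ ball (0 : ℂ) (1 / 4), f z = 0
  · exact (differentiableAt_const (0 : ℂ)).congr_of_eventuallyEq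
      (Filter.mem_of_superset hnhds hzero)
  push Not at hzero
  obtain ⟨α, hα, hfα⟩ := hzero
  have hsub : ball (0 : ℂ) (1 / 4) ⊆ ball 0 1 := ball_subset_ball (by norm_num)
  obtain ⟨H, hH, hHre⟩ := exists_analyticOnNhd_re_eq hf hd
  obtain ⟨K, hK, hKre⟩ := exists_analyticOnNhd_re_eq (f := fun z ↦ -I * f z)
    (continuousOn_const.mul hf) (fun z hz h ↦ (hd z hz (right_ne_zero_of_mul h)).const_mul _)
  have hKim : ∀ z ∈ ball (0 : ℂ) 1, f z ≠ 0 → (f z).im = (K z).re := fun z hz hfz ↦ by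
    simpa using hKre z hz (by simpa using hfz)
  have hopen := isOpen_ball_inter_ne_zero hf
  have hderiv : ∀ z ∈ ball (0 : ℂ) 1 ∩ {z | f z ≠ 0}, deriv (fun z ↦ H z - I * K z) z = 0 := by
    intro z hz
    have hfz := hd z hz.1 hz.2
    have hHz := (hH z hz.1).differentiableAt
    have hKz := (hK z hz.1).differentiableAt
    have h₁ : deriv (fun z ↦ f z - H z) z = 0 := by
      refine (hfz.sub hHz).deriv_eq_zero_of_re_eventuallyEq (c := 0) ?_
      filter_upwards [hopen.mem_nhds hz] with w hw
      simp [hHre w hw.1 hw.2]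
    have h₂ : deriv (fun z ↦ -I * f z - K z) z = 0 := by
      refine ((hfz.const_mul _).sub hKz).deriv_eq_zero_of_re_eventuallyEq (c := 0) ?_
      filter_upwards [hopen.mem_nhds hz] with w hw
      simp [hKim w hw.1 hw.2]
    rw [deriv_fun_sub hfz hHz] at h₁
    rw [deriv_fun_sub (hfz.const_mul _) hKz, deriv_const_mul _ hfz] at h₂
    rw [deriv_fun_sub hHz (hKz.const_mul _), deriv_const_mul _ hKz]
    linear_combination -h₁ + I * h₂ + (deriv f z) * I_sq
  have hA : AnalyticOnNhd ℂ (fun z ↦ H z - I * K z) (ball 0 1) :=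
    hH.sub (analyticOnNhd_const.mul hK)
  have hderiv_zero : EqOn (deriv fun z ↦ H z - I * K z) 0 (ball 0 1) :=
    hA.deriv.eqOn_zero_of_preconnected_of_eventuallyEq_zero (convex_ball _ _).isPreconnected
      (hsub hα) (Filter.mem_of_superset (hopen.mem_nhds ⟨hsub hα, hfα⟩) hderiv)
  obtain ⟨c, hc⟩ := isOpen_ball.exists_is_const_of_deriv_eq_zero
    (convex_ball _ _).isPreconnected hA.differentiableOn hderiv_zero
  have heq : EqOn f (fun z ↦ I * K z + c.re) (ball 0 (1 / 4) ∩ (ball 0 1 ∩ {z | f z ≠ 0})) := by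
    rintro z ⟨-, hz, hfz⟩
    have hcre := congrArg re (hc z hz)
    simp only [sub_re, mul_re, I_re, I_im] at hcre
    apply Complex.ext
    · simp [hHre z hz hfz, ← hcre]
    · simp [hKim z hz hfz]
  have hdiffK : DifferentiableOn ℂ (fun z ↦ I * K z + c.re) (ball 0 (1 / 4)) :=
    ((hK.differentiableOn.mono hsub).const_mul _).add_const _
  have heq' := heq.of_subset_closure (hf.mono (hsub.trans ball_subset_closedBall))
    hdiffK.continuousOn inter_subset_left ((subset_inter Subset.rfl
      (ball_subset_closure_ne_zero hf hd hα hfα)).trans isOpen_ball.inter_closure)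
  exact (hdiffK.congr heq').differentiableAt hnhds

end UnitDisc

/-- **Radó's theorem** in the complex plane: a continuous function on an open
set `U ⊆ ℂ` that is complex-differentiable at every point of `U` off its zero
set is holomorphic on all of `U`. -/
theorem rado_complex_plane (U : Set ℂ) (hU : IsOpen U) (f : ℂ → ℂ)
    (hf : ContinuousOn f U)
    (hdiff : ∀ z ∈ U \ {z ∈ U | f z = 0}, DifferentiableAt ℂ f z) :
    DifferentiableOn ℂ f U := by
  intro c hc
  obtain ⟨R, hR, hRU⟩ := Metric.nhds_basis_closedBall.mem_iff.1 (hU.mem_nhds hc)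
  have hmaps : Set.MapsTo (fun z : ℂ ↦ c + R * z) (Metric.closedBall 0 1) U := by
    intro z hz
    apply hRU
    rw [mem_closedBall_zero_iff] at hz
    simpa [abs_of_pos hR] using mul_le_of_le_one_right hR.le hz
  have hdisc := differentiableAt_zero_of_differentiableAt_ne_zero
    (f := fun z ↦ f (c + R * z)) (hf.comp (by fun_prop) hmaps) fun z hz hfz ↦ by
      have := hdiff (c + R * z) ⟨hmaps (Metric.ball_subset_closedBall hz), fun h ↦ hfz h.2⟩
      exact this.comp (f := fun z : ℂ ↦ c + R * z) z (by fun_prop)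
  have hR' : (R : ℂ) ≠ 0 := Complex.ofReal_ne_zero.2 hR.ne'
  have hcomp : DifferentiableAt ℂ (fun w ↦ f (c + R * ((w - c) / R))) c :=
    DifferentiableAt.comp (f := fun w : ℂ ↦ (w - c) / R) (g := fun z ↦ f (c + R * z)) c
      (by simpa using hdisc) (by fun_prop)
  have hid : (fun w ↦ f (c + R * ((w - c) / R))) = f := by
    ext w
    rw [mul_div_cancel₀ _ hR', add_sub_cancel]
  exact (hid ▸ hcomp).differentiableWithinAt
end

section
/- Let n be a natural number, let U be an open subset of ℂⁿ = (Fin n → ℂ), and let f : ℂⁿ → ℂ be continuous on U. If f is complex-differentiable at every point of U \ {z ∈ U : f z = 0}, then f is holomorphic on all of U (DifferentiableOn ℂ f U). -/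
section

open Set Filter Topology Metric

section MaximumPrinciple

variable {f g : ℂ → ℂ} {c : ℂ} {R M : ℝ}

/-- The maximum principle off the zero set of `f`: zeros of `f` in the disc can be ignored. -/
lemma norm_le_of_norm_le_sphere_off_zeros (hf : ContinuousOn f (closedBall c R))
    (hfd : ∀ z ∈ ball c R, f z ≠ 0 → DifferentiableAt ℂ f z)
    (hg : ContinuousOn g (closedBall c R))
    (hgd : ∀ z ∈ ball c R, f z ≠ 0 → DifferentiableAt ℂ g z)
    (hM : ∀ z ∈ sphere c R, ‖g z‖ ≤ M) {w : ℂ} (hw : w ∈ ball c R) (hfw : f w ≠ 0) :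
    ‖g w‖ ≤ M := by
  have hR : 0 < R := pos_of_mem_ball hw
  obtain ⟨B, hB⟩ := (isCompact_closedBall c R).exists_bound_of_continuousOn hf
  have hM0 : 0 ≤ M := by
    obtain ⟨z, hz⟩ := NormedSpace.sphere_nonempty (E := ℂ) (x := c) |>.2 hR.le
    exact (norm_nonneg _).trans (hM z hz)
  set W : Set ℂ := ball c R ∩ f ⁻¹' {0}ᶜ with hW
  have hWo : IsOpen W :=
    (hf.mono ball_subset_closedBall).isOpen_inter_preimage isOpen_ball isOpen_compl_singleton
  have hWcl : closure W ⊆ closedBall c R :=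
    (closure_mono inter_subset_left).trans closure_ball_subset_closedBall
  have key : ∀ n : ℕ, ‖g w ^ n * f w‖ ≤ M ^ n * B := by
    intro n
    refine Complex.norm_le_of_forall_mem_frontier_norm_le (f := fun z ↦ g z ^ n * f z)
      (isBounded_ball.subset inter_subset_left) ⟨?_, ((hg.pow n).mul hf).mono hWcl⟩ ?_
      (subset_closure (show w ∈ W from ⟨hw, hfw⟩))
    · exact fun z hz ↦ (((hgd z hz.1 hz.2).pow n).mul (hfd z hz.1 hz.2)).differentiableWithinAt
    · intro z hz
      rw [hWo.frontier_eq] at hz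
      have hzc := hWcl hz.1
      rw [norm_mul, norm_pow]
      have hB0 : 0 ≤ B := (norm_nonneg _).trans (hB z hzc)
      by_cases hzf : f z = 0
      · rw [hzf, norm_zero, mul_zero]; positivity
      · have hzs : z ∈ sphere c R := by
          rw [mem_sphere]
          refine le_antisymm hzc (not_lt.1 fun h ↦ hz.2 ⟨h, hzf⟩)
        gcongr
        · exact hM z hzs
        · exact hB z hzc
  by_contra! hlt
  have hgw : 0 < ‖g w‖ := hM0.trans_lt hlt
  have hlim : Tendsto (fun n : ℕ ↦ (M / ‖g w‖) ^ n * B) atTop (𝓝 (0 * B)) :=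
    (tendsto_pow_atTop_nhds_zero_of_lt_one (by positivity) ((div_lt_one hgw).2 hlt)).mul_const B
  rw [zero_mul] at hlim
  refine hfw (norm_le_zero_iff.1 (ge_of_tendsto' hlim fun n ↦ ?_))
  have := key n
  rw [norm_mul, norm_pow] at this
  rw [div_pow, div_mul_eq_mul_div, le_div_iff₀ (by positivity)]
  linarith

lemma re_le_of_re_le_sphere_off_zeros (hf : ContinuousOn f (closedBall c R))
    (hfd : ∀ z ∈ ball c R, f z ≠ 0 → DifferentiableAt ℂ f z)
    (hg : ContinuousOn g (closedBall c R))
    (hgd : ∀ z ∈ ball c R, f z ≠ 0 → DifferentiableAt ℂ g z)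
    (hM : ∀ z ∈ sphere c R, (g z).re ≤ M) {w : ℂ} (hw : w ∈ ball c R) (hfw : f w ≠ 0) :
    (g w).re ≤ M := by
  have := norm_le_of_norm_le_sphere_off_zeros (g := fun z ↦ Complex.exp (g z)) (M := Real.exp M)
    hf hfd (Complex.continuous_exp.comp_continuousOn hg) (fun z hz h ↦ (hgd z hz h).cexp)
    (fun z hz ↦ by simpa [Complex.norm_exp] using hM z hz) hw hfw
  simpa [Complex.norm_exp] using this

lemma abs_re_le_of_abs_re_le_sphere_off_zeros (hf : ContinuousOn f (closedBall c R))
    (hfd : ∀ z ∈ ball c R, f z ≠ 0 → DifferentiableAt ℂ f z)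
    (hg : ContinuousOn g (closedBall c R))
    (hgd : ∀ z ∈ ball c R, f z ≠ 0 → DifferentiableAt ℂ g z)
    (hM : ∀ z ∈ sphere c R, |(g z).re| ≤ M) {w : ℂ} (hw : w ∈ ball c R) (hfw : f w ≠ 0) :
    |(g w).re| ≤ M := by
  rw [abs_le']
  exact ⟨re_le_of_re_le_sphere_off_zeros hf hfd hg hgd (fun z hz ↦ (abs_le'.1 (hM z hz)).1) hw hfw,
    re_le_of_re_le_sphere_off_zeros (g := fun z ↦ -g z) hf hfd hg.neg
      (fun z hz h ↦ (hgd z hz h).neg) (fun z hz ↦ (abs_le'.1 (hM z hz)).2) hw hfw⟩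

end MaximumPrinciple

section Approximation

open scoped ComplexConjugate

/-- Elements of the linear span of the Fourier monomials are sums of boundary values of a
holomorphic and an antiholomorphic function. -/
lemma exists_differentiable_add_conj_of_mem_span_fourier {T : ℝ} {h : C(AddCircle T, ℂ)}
    (hh : h ∈ Submodule.span ℂ (range (fourier (T := T)))) :
    ∃ a b : ℂ → ℂ, Differentiable ℂ a ∧ Differentiable ℂ b ∧
      ∀ x : AddCircle T, h x = a (AddCircle.toCircle x) + conj (b (AddCircle.toCircle x)) := by
  induction hh using Submodule.span_induction with
  | mem x hx =>
    obtain ⟨n, rfl⟩ := hx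
    obtain ⟨m, rfl | rfl⟩ := n.eq_nat_or_neg
    · exact ⟨fun z ↦ z ^ m, 0, by fun_prop, by fun_prop, fun x ↦ by
        simp [AddCircle.toCircle_nsmul]⟩
    · refine ⟨0, fun z ↦ z ^ m, by fun_prop, by fun_prop, fun x ↦ ?_⟩
      rw [fourier_neg]
      simp [AddCircle.toCircle_nsmul]
  | zero => exact ⟨0, 0, by fun_prop, by fun_prop, by simp⟩
  | add x y _ _ hx hy =>
    obtain ⟨a, b, ha, hb, h⟩ := hx
    obtain ⟨a', b', ha', hb', h'⟩ := hy
    refine ⟨a + a', b + b', ha.add ha', hb.add hb', fun z ↦ ?_⟩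
    simp only [ContinuousMap.add_apply, h, h', Pi.add_apply, map_add]
    ring
  | smul k x _ hx =>
    obtain ⟨a, b, ha, hb, h⟩ := hx
    refine ⟨k • a, conj k • b, ha.const_smul k, hb.const_smul _, fun z ↦ ?_⟩
    simp only [ContinuousMap.smul_apply, h, Pi.smul_apply, smul_eq_mul, map_mul, Complex.conj_conj]
    ring

/-- Real parts of entire functions are uniformly dense in the real continuous functions on the
unit circle. -/
lemma exists_differentiable_abs_re_sub_le {u : ℂ → ℂ} (hu : ContinuousOn u (sphere 0 1))
    {ε : ℝ} (hε : 0 < ε) :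
    ∃ p : ℂ → ℂ, Differentiable ℂ p ∧ ∀ z ∈ sphere (0 : ℂ) 1, |(u z - p z).re| ≤ ε := by
  have : Fact (0 < 2 * Real.pi) := ⟨Real.two_pi_pos⟩
  let U : C(AddCircle (2 * Real.pi), ℂ) :=
    ⟨fun x ↦ u (AddCircle.toCircle x), hu.comp_continuous
      (continuous_subtype_val.comp AddCircle.continuous_toCircle) fun x ↦ by
        rw [mem_sphere_zero_iff_norm, Circle.norm_coe]⟩
  have hU : U ∈ (Submodule.span ℂ (range (fourier (T := 2 * Real.pi)))).topologicalClosure := by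
    rw [span_fourier_closure_eq_top]; trivial
  obtain ⟨h, hh, hd⟩ := Metric.mem_closure_iff.1 hU ε hε
  obtain ⟨a, b, ha, hb, hab⟩ := exists_differentiable_add_conj_of_mem_span_fourier hh
  refine ⟨a + b, ha.add hb, fun z hz ↦ ?_⟩
  obtain ⟨x, hx⟩ := (AddCircle.homeomorphCircle Real.two_pi_pos.ne').surjective ⟨z, hz⟩
  have hxz : (AddCircle.toCircle x : ℂ) = z := by
    rw [← AddCircle.homeomorphCircle_apply Real.two_pi_pos.ne', hx]
  have h1 := (ContinuousMap.dist_apply_le_dist x).trans hd.le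
  rw [dist_eq_norm, hab] at h1
  calc |(u z - (a + b) z).re| = |(U x - (a (AddCircle.toCircle x)
        + conj (b (AddCircle.toCircle x)))).re| := by simp [U, hxz]
    _ ≤ _ := Complex.abs_re_le_norm _
    _ ≤ ε := h1

end Approximation

section UnitDisc

variable {f g : ℂ → ℂ}

/-- Off the zeros of `f`, the real part of `g` is the real part of a function which is holomorphic
in the whole disc. -/
lemma exists_differentiableOn_re_eq_off_zeros (hf : ContinuousOn f (closedBall 0 1))
    (hfd : ∀ z ∈ ball 0 1, f z ≠ 0 → DifferentiableAt ℂ f z)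
    (hg : ContinuousOn g (closedBall 0 1))
    (hgd : ∀ z ∈ ball 0 1, f z ≠ 0 → DifferentiableAt ℂ g z) :
    ∃ P : ℂ → ℂ, DifferentiableOn ℂ P (ball 0 1) ∧
      ∀ w ∈ ball 0 1, f w ≠ 0 → (P w).re = (g w).re := by
  have hgs : ContinuousOn (fun z ↦ (g z).re) (sphere 0 1) :=
    Complex.continuous_re.comp_continuousOn (hg.mono sphere_subset_closedBall)
  have hgi : CircleIntegrable (fun z ↦ (g z).re) 0 1 := hgs.circleIntegrable zero_le_one
  have hgi' : CircleIntegrable (fun z ↦ ((g z).re : ℂ)) 0 1 :=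
    (Complex.continuous_ofReal.comp_continuousOn hgs).circleIntegrable zero_le_one
  refine ⟨_, differentiableOn_circleAverage_herglotzRieszKernel_smul hgi', fun w hw hfw ↦ ?_⟩
  rw [re_circleAverage_herglotzRieszKernel_smul hgi hw, ← sub_eq_zero]
  have hK : ContinuousOn (Complex.re ∘ herglotzRieszKernel 0 w) (sphere 0 1) := by
    have := continuousOn_herglotzRieszKernel_sphere hw
    rw [abs_one] at this
    exact Complex.continuous_re.comp_continuousOn this
  have hKpos : ∀ z ∈ sphere (0 : ℂ) 1, 0 ≤ (herglotzRieszKernel 0 w z).re := fun z hz ↦ by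
    refine le_trans ?_ (le_re_herglotzRieszKernel hz hw)
    have : ‖w‖ < 1 := by simpa using hw
    rw [sub_zero]
    have := norm_nonneg w
    apply div_nonneg <;> linarith
  have hre : ∀ p : ℂ → ℂ, Differentiable ℂ p → Real.circleAverage
      ((Complex.re ∘ herglotzRieszKernel 0 w) • fun z ↦ (p z).re) 0 1 = (p w).re := fun p hp ↦
    InnerProductSpace.HarmonicOnNhd.circleAverage_re_herglotzRieszKernel_smul
      (fun z _ ↦ (hp.analyticAt z).harmonicAt_re) hw
  refine abs_nonpos_iff.1 (le_of_forall_pos_le_add fun ε hε ↦ ?_)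
  obtain ⟨p, hp, hpu⟩ := exists_differentiable_abs_re_sub_le
    (hg.mono sphere_subset_closedBall) (half_pos hε)
  have hpw := abs_re_le_of_abs_re_le_sphere_off_zeros (g := fun z ↦ g z - p z) hf hfd
    (hg.sub hp.continuous.continuousOn) (fun z hz h ↦ (hgd z hz h).sub (hp z)) hpu hw hfw
  have hps : ContinuousOn (fun z ↦ (p z).re) (sphere 0 1) :=
    (Complex.continuous_re.comp hp.continuous).continuousOn
  have hsub : Real.circleAverage ((Complex.re ∘ herglotzRieszKernel 0 w) • fun z ↦ (g z).re) 0 1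
      - (p w).re = Real.circleAverage
        ((Complex.re ∘ herglotzRieszKernel 0 w) • fun z ↦ (g z - p z).re) 0 1 := by
    rw [← hre p hp, ← Real.circleAverage_sub ((hK.smul hgs).circleIntegrable zero_le_one)
      ((hK.smul hps).circleIntegrable zero_le_one)]
    congr 1
    ext z
    simp [mul_sub]
  have hsubs : ContinuousOn (fun z ↦ (g z - p z).re) (sphere 0 1) := by
    simpa using! hgs.sub hps
  have hle : |Real.circleAverage
      ((Complex.re ∘ herglotzRieszKernel 0 w) • fun z ↦ (g z - p z).re) 0 1| ≤ ε / 2 := by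
    refine Real.abs_circleAverage_le_circleAverage_abs.trans ?_
    have hε' := hre (fun _ ↦ ((ε / 2 : ℝ) : ℂ)) (by fun_prop)
    simp only [Complex.ofReal_re] at hε'
    rw [← hε']
    refine Real.circleAverage_mono ((hK.smul hsubs).abs.circleIntegrable zero_le_one)
      ((hK.smul continuousOn_const).circleIntegrable zero_le_one) fun z hz ↦ ?_
    rw [abs_one] at hz
    simp only [Pi.abs_apply, smul_eq_mul, Pi.mul_apply, Function.comp_apply, abs_mul,
      abs_of_nonneg (hKpos z hz)]
    exact mul_le_mul_of_nonneg_left (hpu z hz) (hKpos z hz)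
  rw [← hsub] at hle
  rw [Complex.sub_re] at hpw
  rw [abs_le] at *
  constructor <;> linarith [hle.1, hle.2, hpw.1, hpw.2]

/-- Off its zeros, `f` agrees with a function which is holomorphic in the whole disc. -/
lemma exists_differentiableOn_eq_off_zeros (hf : ContinuousOn f (closedBall 0 1))
    (hfd : ∀ z ∈ ball 0 1, f z ≠ 0 → DifferentiableAt ℂ f z) :
    ∃ H : ℂ → ℂ, DifferentiableOn ℂ H (ball 0 1) ∧ ∀ w ∈ ball 0 1, f w ≠ 0 → H w = f w := by
  by_cases hne : ∃ w ∈ ball (0 : ℂ) 1, f w ≠ 0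
  swap
  · push Not at hne
    exact ⟨0, differentiableOn_const _, fun w hw h ↦ absurd (hne w hw) h⟩
  obtain ⟨w₀, hw₀, hfw₀⟩ := hne
  obtain ⟨P, hP, hPf⟩ := exists_differentiableOn_re_eq_off_zeros hf hfd hf hfd
  obtain ⟨Q, hQ, hQf⟩ := exists_differentiableOn_re_eq_off_zeros (g := fun z ↦ Complex.I * f z)
    hf hfd (continuousOn_const.mul hf) (fun z hz h ↦ (hfd z hz h).const_mul _)
  have hWo : IsOpen (ball (0 : ℂ) 1 ∩ f ⁻¹' {0}ᶜ) :=
    (hf.mono ball_subset_closedBall).isOpen_inter_preimage isOpen_ball isOpen_compl_singleton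
  obtain ⟨r, hr, hrW⟩ := Metric.isOpen_iff.1 hWo w₀ ⟨hw₀, hfw₀⟩
  have hfr : DifferentiableOn ℂ f (ball w₀ r) := fun z hz ↦
    (hfd z (hrW hz).1 (hrW hz).2).differentiableWithinAt
  have hrb : ball w₀ r ⊆ ball 0 1 := hrW.trans inter_subset_left
  obtain ⟨α, hα⟩ := AnalyticOnNhd.eq_re_add_const_mul_I_of_re_eq_const (f := fun z ↦ f z - P z)
    (c₀ := 0) ((hfr.sub (hP.mono hrb)).analyticOnNhd isOpen_ball)
    (fun z hz ↦ by rw [Complex.sub_re, hPf z (hrW hz).1 (hrW hz).2, sub_self])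
    isOpen_ball (isConnected_ball hr)
  obtain ⟨β, hβ⟩ := AnalyticOnNhd.eq_re_add_const_mul_I_of_re_eq_const
    (f := fun z ↦ Complex.I * f z - Q z) (c₀ := 0)
    (((hfr.const_mul _).sub (hQ.mono hrb)).analyticOnNhd isOpen_ball)
    (fun z hz ↦ by rw [Complex.sub_re, hQf z (hrW hz).1 (hrW hz).2, sub_self])
    isOpen_ball (isConnected_ball hr)
  have hPQ : EqOn (fun z ↦ Complex.I * (P z + α * Complex.I) - β * Complex.I) Q (ball 0 1) := by
    refine AnalyticOnNhd.eqOn_of_preconnected_of_eventuallyEq (z₀ := w₀)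
      ((((hP.add_const _).const_mul _).sub_const _).analyticOnNhd isOpen_ball)
      (hQ.analyticOnNhd isOpen_ball) isPreconnected_ball hw₀ ?_
    filter_upwards [ball_mem_nhds w₀ hr] with z hz
    have h1 := hα z hz
    have h2 := hβ z hz
    simp only [Complex.ofReal_zero, zero_add] at h1 h2
    linear_combination Complex.I * h1 * (-1) + h2
  refine ⟨fun z ↦ P z + α * Complex.I, hP.add_const _, fun w hw hfw ↦ Complex.ext ?_ ?_⟩
  · simpa using hPf w hw hfw
  · have h1 := hQf w hw hfw
    rw [← hPQ hw] at h1
    simp at h1 ⊢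
    linarith

/-- Punctured discs are preconnected. -/
lemma isPreconnected_ball_diff_singleton (a : ℂ) (r : ℝ) : IsPreconnected (ball a r \ {a}) := by
  rcases le_or_gt r 0 with hr | hr
  · simpa [ball_eq_empty.2 hr] using isPreconnected_empty
  have h : (fun z ↦ a + Complex.exp z) '' {z | z.re < Real.log r} = ball a r \ {a} := by
    ext w
    simp only [mem_image, mem_ofPred_eq, Set.mem_sdiff, mem_ball, mem_singleton_iff]
    constructor
    · rintro ⟨z, hz, rfl⟩
      rw [dist_eq_norm, add_sub_cancel_left, Complex.norm_exp]
      exact ⟨(Real.lt_log_iff_exp_lt hr).1 hz, by simp⟩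
    · rintro ⟨hw, hwa⟩
      have hne : w - a ≠ 0 := sub_ne_zero.2 hwa
      refine ⟨Complex.log (w - a), ?_, by rw [Complex.exp_log hne]; ring⟩
      rw [Complex.log_re]
      exact Real.log_lt_log (norm_pos_iff.2 hne) (by rwa [← dist_eq_norm])
  rw [← h]
  exact (convex_halfSpace_re_lt _).isPreconnected.image _ (by fun_prop)

/-- **Radó's theorem** for the unit disc. -/
lemma differentiableOn_unit_ball_of_off_zeros (hf : ContinuousOn f (closedBall 0 1))
    (hfd : ∀ z ∈ ball 0 1, f z ≠ 0 → DifferentiableAt ℂ f z) :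
    DifferentiableOn ℂ f (ball 0 1) := by
  by_cases hne : ∃ w ∈ ball (0 : ℂ) 1, f w ≠ 0
  swap
  · push Not at hne
    exact (differentiableOn_const 0).congr hne
  obtain ⟨w₀, hw₀, hfw₀⟩ := hne
  obtain ⟨H, hH, hHf⟩ := exists_differentiableOn_eq_off_zeros hf hfd
  have hHa := hH.analyticOnNhd isOpen_ball
  have hfb : ContinuousOn f (ball 0 1) := hf.mono ball_subset_closedBall
  set W := ball (0 : ℂ) 1 ∩ f ⁻¹' {0}ᶜ with hW
  have hWo : IsOpen W := hfb.isOpen_inter_preimage isOpen_ball isOpen_compl_singleton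
  have hWH : EqOn f H W := fun z hz ↦ (hHf z hz.1 hz.2).symm
  have hcl : ∀ s : Set ℂ, EqOn f H s → EqOn f H (closure s ∩ ball 0 1) := by
    rintro s hs a ⟨has, hab⟩
    have : (𝓝[s] a).NeBot := mem_closure_iff_nhdsWithin_neBot.1 has
    have h1 : Tendsto f (𝓝[s] a) (𝓝 (f a)) :=
      ((hfb.continuousAt (isOpen_ball.mem_nhds hab)).tendsto).mono_left nhdsWithin_le_nhds
    have h2 : Tendsto H (𝓝[s] a) (𝓝 (H a)) :=
      ((hHa a hab).continuousAt.tendsto).mono_left nhdsWithin_le_nhds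
    exact tendsto_nhds_unique (h1.congr' (eventually_nhdsWithin_of_forall hs)) h2
  suffices ball (0 : ℂ) 1 ⊆ {z | ∀ᶠ y in 𝓝 z, f y = H y} from
    hH.congr fun z hz ↦ (this hz).self_of_nhds
  have huH : EqOn f H {z | ∀ᶠ y in 𝓝 z, f y = H y} := fun z hz ↦
    Eventually.self_of_nhds (p := fun y ↦ f y = H y) hz
  have hWu : W ⊆ {z | ∀ᶠ y in 𝓝 z, f y = H y} := fun z hz ↦
    hWH.eventuallyEq_of_mem (hWo.mem_nhds hz)
  refine isPreconnected_ball.subset_of_closure_inter_subset isOpen_setOfPred_eventually_nhds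
    ⟨w₀, hw₀, hWu ⟨hw₀, hfw₀⟩⟩ ?_
  rintro a ⟨hau, hab⟩
  by_cases hfa : f a = 0
  swap
  · exact hWu ⟨hab, hfa⟩
  have hfHa : f a = H a := hcl _ huH ⟨hau, hab⟩
  rcases (hHa a hab).eventually_eq_zero_or_eventually_ne_zero with h0 | h0
  · refine absurd (hHa.eqOn_zero_of_preconnected_of_eventuallyEq_zero isPreconnected_ball hab h0
      hw₀) ?_
    rw [hHf w₀ hw₀ hfw₀]
    exact hfw₀
  obtain ⟨r, hr, hrs⟩ := Metric.mem_nhds_iff.1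
    (inter_mem (isOpen_ball.mem_nhds hab) (eventually_nhdsWithin_iff.1 h0))
  by_cases hau' : a ∈ {z | ∀ᶠ y in 𝓝 z, f y = H y}
  · exact hau'
  obtain ⟨y, hyr, hyu⟩ := mem_closure_iff.1 hau _ isOpen_ball (mem_ball_self hr)
  have hya : y ≠ a := fun h ↦ hau' (h ▸ hyu)
  have hN : ball a r \ {a} ⊆ W := by
    refine (isPreconnected_ball_diff_singleton a r).subset_of_closure_inter_subset hWo
      ⟨y, ⟨hyr, hya⟩, (hrs hyr).1, ?_⟩ ?_
    · rw [mem_preimage, huH hyu]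
      exact (hrs hyr).2 hya
    · rintro z ⟨hzW, hzr, hza⟩
      refine ⟨(hrs hzr).1, ?_⟩
      rw [mem_preimage, hcl W hWH ⟨hzW, (hrs hzr).1⟩]
      exact (hrs hzr).2 hza
  filter_upwards [ball_mem_nhds a hr] with z hz
  by_cases hza : z = a
  · rw [hza, hfHa]
  · exact hWH (hN ⟨hz, hza⟩)

end UnitDisc

/-- **Radó's theorem** for discs, at the centre. -/
lemma differentiableAt_zero_of_off_zeros {g : ℂ → ℂ} {R : ℝ} (hR : 0 < R)
    (hg : ContinuousOn g (closedBall 0 R))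
    (hgd : ∀ z ∈ ball 0 R, g z ≠ 0 → DifferentiableAt ℂ g z) : DifferentiableAt ℂ g 0 := by
  have hR' : (R : ℂ) ≠ 0 := by exact_mod_cast hR.ne'
  have hnorm : ∀ z : ℂ, ‖(R : ℂ) * z‖ = R * ‖z‖ := fun z ↦ by
    rw [norm_mul, Complex.norm_real, Real.norm_of_nonneg hR.le]
  have hball : DifferentiableOn ℂ (fun z ↦ g (R * z)) (ball 0 1) := by
    refine differentiableOn_unit_ball_of_off_zeros
      (hg.comp (by fun_prop) fun z hz ↦ ?_) fun z hz h ↦ ?_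
    · rw [mem_closedBall_zero_iff] at hz ⊢
      rw [hnorm]
      nlinarith
    · refine (hgd (R * z) ?_ h).comp z (by fun_prop)
      rw [mem_ball_zero_iff] at hz ⊢
      rw [hnorm]
      nlinarith
  have h0 : DifferentiableAt ℂ (fun z ↦ g (R * z)) ((R : ℂ)⁻¹ * 0) := by
    rw [mul_zero]
    exact hball.differentiableAt (ball_mem_nhds 0 one_pos)
  have h1 := h0.comp (0 : ℂ) (f := fun z ↦ (R : ℂ)⁻¹ * z) (by fun_prop)
  exact h1.congr_of_eventuallyEq (.of_forall fun z ↦ by simp [mul_inv_cancel_left₀ hR'])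

section Osgood

variable {V E E₁ E₂ : Type*} [NormedAddCommGroup V] [NormedSpace ℂ V]
  [NormedAddCommGroup E] [NormedSpace ℂ E] [NormedAddCommGroup E₁] [NormedSpace ℂ E₁]
  [NormedAddCommGroup E₂] [NormedSpace ℂ E₂]

/-- `f` is complex differentiable at every point of `U` in the directions given by `L`. -/
def DifferentiableAlong (f : V → ℂ) (U : Set V) (L : E →L[ℂ] V) : Prop :=
  ∀ v ∈ U, DifferentiableAt ℂ (fun h ↦ f (v + L h)) 0

lemma DifferentiableAlong.hasFDerivAt {f : V → ℂ} {U : Set V} {L : E →L[ℂ] V}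
    (hf : DifferentiableAlong f U L) {v : V} {a : E} (ha : v + L a ∈ U) :
    HasFDerivAt (fun h ↦ f (v + L h)) (fderiv ℂ (fun h ↦ f (v + L a + L h)) 0) a := by
  have h : HasFDerivAt (fun h ↦ f (v + L a + L h)) (fderiv ℂ (fun h ↦ f (v + L a + L h)) 0)
      (a - a) := by
    rw [sub_self]
    exact (hf _ ha).hasFDerivAt
  have h' := HasFDerivAt.comp (f := fun x ↦ x - a) a h ((hasFDerivAt_id a).sub_const a)
  refine (h'.congr_fderiv (by ext; simp)).congr_of_eventuallyEq (Eventually.of_forall fun x ↦ ?_)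
  simp

lemma DifferentiableAlong.continuousOn_fderiv [ProperSpace V] {f : V → ℂ} {U : Set V}
    (hU : IsOpen U) (hc : ContinuousOn f U) {L : E →L[ℂ] V} (hf : DifferentiableAlong f U L) :
    ContinuousOn (fun v ↦ fderiv ℂ (fun h ↦ f (v + L h)) 0) U := by
  intro u hu
  obtain ⟨r, hr, hrU⟩ := Metric.nhds_basis_closedBall.mem_iff.1 (hU.mem_nhds hu)
  have huc := (isCompact_closedBall u r).uniformContinuousOn_of_continuous (hc.mono hrU)
  rw [Metric.uniformContinuousOn_iff] at huc
  apply ContinuousAt.continuousWithinAt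
  rw [Metric.continuousAt_iff]
  intro ε hε
  set ρ : ℝ := r / 2 / (‖L‖ + 1) with hρ
  have hL : 0 < ‖L‖ + 1 := by positivity
  have hρ0 : 0 < ρ := by positivity
  obtain ⟨δ, hδ, hδf⟩ := huc (ε / 3 * ρ) (by positivity)
  refine ⟨min δ (r / 2), by positivity, fun {w} hw ↦ ?_⟩
  have hLh : ∀ h ∈ ball (0 : E) ρ, ‖L h‖ < r / 2 := fun h hh ↦ by
    rw [mem_ball_zero_iff] at hh
    calc ‖L h‖ ≤ ‖L‖ * ‖h‖ := L.le_opNorm h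
      _ ≤ (‖L‖ + 1) * ‖h‖ := by gcongr; linarith
      _ < (‖L‖ + 1) * ρ := by gcongr
      _ = r / 2 := by rw [hρ]; field_simp
  have hmem : ∀ x, dist x u < r / 2 → ∀ h ∈ ball (0 : E) ρ, x + L h ∈ closedBall u r := by
    intro x hx h hh
    rw [mem_closedBall, dist_eq_norm, add_sub_right_comm]
    rw [dist_eq_norm] at hx
    linarith [norm_add_le (x - u) (L h), hLh h hh]
  have hwr : dist w u < r / 2 := hw.trans_le (min_le_right _ _)
  have hur : dist u u < r / 2 := by simpa using half_pos hr
  have hwU : w ∈ U := hrU (by simpa using hmem w hwr 0 (by simpa))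
  have hdiff : DifferentiableOn ℂ (fun h ↦ f (w + L h) - f (u + L h)) (ball 0 ρ) := fun h hh ↦
    ((hf.hasFDerivAt (hrU (hmem w hwr h hh))).differentiableAt.sub
      (hf.hasFDerivAt (hrU (hmem u hur h hh))).differentiableAt).differentiableWithinAt
  have hbd : ∀ h ∈ ball (0 : E) ρ, ‖f (w + L h) - f (u + L h)‖ < ε / 3 * ρ := fun h hh ↦ by
    rw [← dist_eq_norm]
    refine hδf _ (hmem w hwr h hh) _ (hmem u hur h hh) ?_
    rw [dist_add_right]
    exact hw.trans_le (min_le_left _ _)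
  have h0 : (0 : E) ∈ ball 0 ρ := mem_ball_self hρ0
  have hn : ‖fderiv ℂ (fun h ↦ f (w + L h) - f (u + L h)) 0‖ ≤ (ε / 3 * ρ + ε / 3 * ρ) / ρ := by
    refine Complex.norm_fderiv_le_div_of_mapsTo_ball hdiff (fun h hh ↦ ?_) hρ0
    rw [mem_closedBall, dist_eq_norm]
    exact (norm_sub_le _ _).trans (add_le_add (hbd h hh).le (hbd 0 h0).le)
  rw [fderiv_fun_sub (hf w hwU) (hf u hu)] at hn
  rw [dist_eq_norm]
  refine hn.trans_lt ?_
  rw [← add_mul, mul_div_cancel_right₀ _ hρ0.ne']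
  linarith

lemma DifferentiableAlong.coprod [ProperSpace V] {f : V → ℂ} {U : Set V}
    (hU : IsOpen U) (hc : ContinuousOn f U) {L₁ : E₁ →L[ℂ] V} {L₂ : E₂ →L[ℂ] V}
    (h₁ : DifferentiableAlong f U L₁) (h₂ : DifferentiableAlong f U L₂) :
    DifferentiableAlong f U (L₁.coprod L₂) := by
  intro v hv
  have hcont : Continuous fun p : E₁ × E₂ ↦ v + L₁ p.1 + L₂ p.2 := by fun_prop
  have hmem : ∀ᶠ p : E₁ × E₂ in 𝓝 0, v + L₁ p.1 + L₂ p.2 ∈ U :=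
    hcont.continuousAt.eventually_mem (by simpa using hU.mem_nhds hv)
  have := hasStrictFDerivAt_uncurry_coprod (𝕜 := ℂ) (u := (0 : E₁ × E₂))
    (f := fun a b ↦ f (v + L₁ a + L₂ b))
    (f₁ := fun a b ↦ fderiv ℂ (fun h ↦ f (v + L₁ a + L₂ b + L₁ h)) 0)
    (f₂ := fun a b ↦ fderiv ℂ (fun h ↦ f (v + L₁ a + L₂ b + L₂ h)) 0) ?_ ?_ ?_ ?_
  · simpa [Function.HasUncurry.uncurry, add_assoc] using this.hasFDerivAt.differentiableAt
  · filter_upwards [hmem] with p hp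
    have := h₁.hasFDerivAt (v := v + L₂ p.2) (a := p.1) (by rwa [add_right_comm])
    simpa [Function.HasUncurry.uncurry, add_right_comm] using this
  · filter_upwards [hmem] with p hp
    exact h₂.hasFDerivAt hp
  · exact ContinuousAt.comp_of_eq (f := fun p : E₁ × E₂ ↦ v + L₁ p.1 + L₂ p.2)
      ((h₁.continuousOn_fderiv hU hc).continuousAt (hU.mem_nhds hv)) hcont.continuousAt (by simp)
  · exact ContinuousAt.comp_of_eq (f := fun p : E₁ × E₂ ↦ v + L₁ p.1 + L₂ p.2)
      ((h₂.continuousOn_fderiv hU hc).continuousAt (hU.mem_nhds hv)) hcont.continuousAt (by simp)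

/-- **Osgood's lemma**: a continuous function on an open subset of a finite-dimensional complex
space which is complex differentiable along every complex line is complex differentiable. -/
theorem differentiableOn_of_differentiableAt_lines [FiniteDimensional ℂ V] {f : V → ℂ} {U : Set V}
    (hU : IsOpen U) (hc : ContinuousOn f U)
    (hf : ∀ v ∈ U, ∀ x : V, DifferentiableAt ℂ (fun t : ℂ ↦ f (v + t • x)) 0) :
    DifferentiableOn ℂ f U := by
  have : ProperSpace V := FiniteDimensional.proper ℂ V
  have key : ∀ S : Submodule ℂ V, S.FG → DifferentiableAlong f U S.subtypeL := by
    refine Submodule.fg_induction (fun x v hv ↦ ?_) (fun S₁ S₂ _ _ h₁ h₂ v hv ↦ ?_)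
    · rcases eq_or_ne x 0 with rfl | hx
      · have : Subsingleton (Submodule.span ℂ {(0 : V)}) := by
          rw [Submodule.span_zero_singleton]; infer_instance
        exact (hasFDerivAt_of_subsingleton _ _).differentiableAt
      · let e := ContinuousLinearEquiv.toSpanNonzeroSingleton ℂ x hx
        have h := hf v hv x
        rw [← map_zero e.symm] at h
        refine (h.comp (0 : Submodule.span ℂ {x}) e.symm.differentiableAt).congr_of_eventuallyEq
          (Eventually.of_forall fun s ↦ ?_)
        obtain ⟨t, rfl⟩ := e.surjective s
        simp [e]
    · let p : S₁ × S₂ →ₗ[ℂ] (S₁ ⊔ S₂ : Submodule ℂ V) :=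
        (Submodule.inclusion le_sup_left).coprod (Submodule.inclusion le_sup_right)
      have hp : LinearMap.range p = ⊤ := by
        rw [LinearMap.range_eq_top]
        rintro ⟨s, hs⟩
        obtain ⟨a, ha, b, hb, rfl⟩ := Submodule.mem_sup.1 hs
        exact ⟨(⟨a, ha⟩, ⟨b, hb⟩), Subtype.ext (by simp [p])⟩
      obtain ⟨q, hq⟩ := p.exists_rightInverse_of_surjective hp
      have h := h₁.coprod hU hc h₂ v hv
      rw [← map_zero q.toContinuousLinearMap] at h
      refine (h.comp (0 : (S₁ ⊔ S₂ : Submodule ℂ V))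
        q.toContinuousLinearMap.differentiableAt).congr_of_eventuallyEq
          (Eventually.of_forall fun s ↦ ?_)
      have hs : (p (q s) : V) = s := congrArg Subtype.val (LinearMap.congr_fun hq s)
      simpa [p] using congrArg (fun y ↦ f (v + y)) hs.symm
  intro v hv
  have h := key ⊤ Module.Finite.fg_top v hv
  let e : V →L[ℂ] (⊤ : Submodule ℂ V) := Submodule.topEquiv.symm.toLinearMap.toContinuousLinearMap
  have h' : DifferentiableAt ℂ (fun h ↦ f (v + (⊤ : Submodule ℂ V).subtypeL h)) (e (v - v)) := by
    rw [sub_self, map_zero]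
    exact h
  refine ((h'.comp v (e.differentiableAt.comp v (differentiableAt_id.sub_const v))
    ).congr_of_eventuallyEq (Eventually.of_forall fun s ↦ ?_)).differentiableWithinAt
  simp [e]

end Osgood

end

/-- **Radó's theorem** in several complex variables: a continuous function on
an open set `U ⊆ ℂⁿ` that is complex-differentiable at every point of `U` off
its zero set is holomorphic on all of `U`. -/
theorem rado_several_variables (n : ℕ) (U : Set (Fin n → ℂ)) (hU : IsOpen U)
    (f : (Fin n → ℂ) → ℂ) (hf : ContinuousOn f U)
    (hdiff : ∀ z ∈ U \ {z ∈ U | f z = 0}, DifferentiableAt ℂ f z) :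
    DifferentiableOn ℂ f U := by
  refine differentiableOn_of_differentiableAt_lines hU hf fun v hv x ↦ ?_
  have hl : Continuous fun t : ℂ ↦ v + t • x := by fun_prop
  obtain ⟨R, hR, hRU⟩ := Metric.nhds_basis_closedBall.mem_iff.1
    (hl.continuousAt.preimage_mem_nhds (x := 0) (hU.mem_nhds (by simpa using hv)))
  refine differentiableAt_zero_of_off_zeros hR (hf.comp hl.continuousOn hRU) fun t ht h ↦ ?_
  exact (hdiff (v + t • x) ⟨hRU (Metric.ball_subset_closedBall ht), fun h' ↦ h h'.2⟩).comp t
    (by fun_prop)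
end

section
/- Let p, q ≥ 2 be coprime integers, and let m, n be natural numbers with m·q − n·p = 1. Define h on Γ = {(z₁, z₂) ∈ ℂ × ℂ : z₁^p = z₂^q} by h(z₁, z₂) = z₁^m / z₂^n if z₂ ≠ 0 and h(z₁, z₂) = 0 if z₂ = 0. Then h is continuous on Γ (with the subspace topology), and h(t^q, t^p) = t for every t ∈ ℂ. -/
open Filter Topology in
/-- A function whose `p`-th power tends to `0` itself tends to `0`. -/
theorem tendsto_zero_of_tendsto_pow_zero {α : Type*} {l : Filter α} {f : α → ℂ} {p : ℕ}
    (hf : Tendsto (fun a => f a ^ p) l (𝓝 0)) : Tendsto f l (𝓝 0) := by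
  rw [Metric.tendsto_nhds] at hf ⊢
  intro ε hε
  filter_upwards [hf (ε ^ p) (by positivity)] with a ha
  rw [dist_zero_right] at ha ⊢
  rw [norm_pow] at ha
  exact lt_of_pow_lt_pow_left₀ p hε.le ha

/-- On the curve `z ^ p = w ^ q`, the function `z ^ m / w ^ n` is a `p`-th root of `w`. -/
theorem div_pow_eq_of_pow_eq_pow {p q m n : ℕ} {z w : ℂ} (hmn : m * q = n * p + 1)
    (hw : w ≠ 0) (hzw : z ^ p = w ^ q) : (z ^ m / w ^ n) ^ p = w := by
  rw [div_pow, ← pow_mul, ← pow_mul, mul_comm m p, pow_mul, hzw, ← pow_mul, mul_comm q m, hmn,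
    pow_succ, mul_div_cancel_left₀ _ (pow_ne_zero _ hw)]

/-- For coprime `p, q ≥ 2` and naturals `m, n` with `m·q − n·p = 1`, the
function `h(z₁, z₂) = z₁^m / z₂^n` (and `0` when `z₂ = 0`) is continuous on
the cusp curve `Γ = {z₁^p = z₂^q}`, and its pullback under the normalization
`t ↦ (t^q, t^p)` is the identity. -/
theorem h_continuous_and_pullback_id (p q m n : ℕ) (hp : 2 ≤ p) (hq : 2 ≤ q)
    (hpq : Nat.Coprime p q) (hmn : (m : ℤ) * q - (n : ℤ) * p = 1)
    (h : ℂ × ℂ → ℂ)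
    (hdef : ∀ z : ℂ × ℂ, h z = if z.2 ≠ 0 then z.1 ^ m / z.2 ^ n else 0) :
    ContinuousOn h {z : ℂ × ℂ | z.1 ^ p = z.2 ^ q} ∧
      ∀ t : ℂ, h (t ^ q, t ^ p) = t := by
  have hp0 : p ≠ 0 := by omega
  have hmn' : m * q = n * p + 1 := by zify; linarith
  refine ⟨fun z _ => ?_, fun t => ?_⟩
  · by_cases hz : z.2 = 0
    · have hhz : h z = 0 := by simp [hdef, hz]
      rw [ContinuousWithinAt, hhz]
      refine tendsto_zero_of_tendsto_pow_zero (p := p) ?_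
      have hsnd : Filter.Tendsto Prod.snd (nhdsWithin z {z : ℂ × ℂ | z.1 ^ p = z.2 ^ q})
          (nhds 0) := by
        rw [← hz]
        exact continuous_snd.continuousWithinAt
      refine hsnd.congr' ?_
      filter_upwards [self_mem_nhdsWithin] with w hw
      by_cases hw0 : w.2 = 0
      · simp [hdef, hw0, hp0]
      · rw [hdef, if_pos hw0, div_pow_eq_of_pow_eq_pow hmn' hw0 hw]
    · have hc : ContinuousAt (fun w : ℂ × ℂ => w.1 ^ m / w.2 ^ n) z :=
        (continuous_fst.pow m).continuousAt.div (continuous_snd.pow n).continuousAt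
          (pow_ne_zero _ hz)
      refine (hc.congr ?_).continuousWithinAt
      filter_upwards [continuous_snd.continuousAt.eventually_ne hz] with w hw
      rw [hdef, if_pos hw]
  · by_cases ht : t = 0
    · simp [hdef, ht, hp0]
    · rw [hdef, if_pos (pow_ne_zero p ht), ← pow_mul, ← pow_mul, mul_comm q m, hmn',
        mul_comm p n, pow_succ, mul_div_cancel_left₀ _ (pow_ne_zero _ ht)]
end

section
/- Let p, q ≥ 2 be coprime integers and let m, n be natural numbers with m·q − n·p = 1. For every natural number k with k ≥ (p − 1)·(q − 1), there exist natural numbers α, β such that for every (z₁, z₂) ∈ ℂ × ℂ with z₁^p = z₂^q one has h(z₁, z₂)^k = z₂^α · z₁^β, where h(z₁, z₂) = z₁^m / z₂^n if z₂ ≠ 0 and h(z₁, z₂) = 0 if z₂ = 0. In particular, h^k is the restriction of a polynomial on ℂ², hence globally holomorphic on Γ. -/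
/-- For coprime `p, q ≥ 2`, naturals `m, n` with `m·q − n·p = 1`, and any
`k ≥ (p−1)(q−1)`, the power `h^k` of `h(z₁, z₂) = z₁^m / z₂^n` (and `0` when
`z₂ = 0`) coincides on the cusp curve `{z₁^p = z₂^q}` with the polynomial
`z₂^α · z₁^β` for suitable naturals `α, β`; in particular `h^k` is globally
holomorphic on the curve. -/
theorem h_pow_k_polynomial (p q m n : ℕ) (hp : 2 ≤ p) (hq : 2 ≤ q)
    (hpq : Nat.Coprime p q) (hmn : (m : ℤ) * q - (n : ℤ) * p = 1)
    (h : ℂ × ℂ → ℂ)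
    (hdef : ∀ z : ℂ × ℂ, h z = if z.2 ≠ 0 then z.1 ^ m / z.2 ^ n else 0)
    (k : ℕ) (hk : (p - 1) * (q - 1) ≤ k) :
    ∃ α β : ℕ, ∀ z : ℂ × ℂ, z.1 ^ p = z.2 ^ q →
      h z ^ k = z.2 ^ α * z.1 ^ β := by
  obtain ⟨a, b, hab⟩ := Nat.exists_add_mul_eq_of_gcd_dvd_of_mul_pred_le p q k
    (by rw [hpq.gcd_eq_one]; exact one_dvd k) hk
  refine ⟨a, b, fun ⟨x, y⟩ hxy => ?_⟩
  simp only at hxy ⊢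
  have hmn' : m * q = n * p + 1 := by zify; linarith
  have hk0 : k ≠ 0 := by
    have : 0 < (p - 1) * (q - 1) := Nat.mul_pos (by lia) (by lia)
    lia
  rw [hdef]
  by_cases hy : y = 0
  · subst hy
    have hx : x = 0 := by
      rw [zero_pow (by lia)] at hxy
      exact eq_zero_of_pow_eq_zero hxy
    subst hx
    have hab0 : a + b ≠ 0 := by
      intro h0
      obtain ⟨rfl, rfl⟩ := Nat.add_eq_zero_iff.mp h0
      simp at hab
      exact hk0 hab.symm
    rw [← pow_add, zero_pow hab0]
    simp [hk0]
  · have hx : x ≠ 0 := by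
      rintro rfl
      rw [zero_pow (by lia)] at hxy
      exact pow_ne_zero q hy hxy.symm
    have hpow_p : (x ^ m / y ^ n) ^ p = y := by
      rw [div_pow, ← pow_mul, ← pow_mul, mul_comm m p, pow_mul, hxy, ← pow_mul,
        mul_comm q m, hmn', pow_succ]
      exact mul_div_cancel_left₀ y (pow_ne_zero _ hy)
    have hpow_q : (x ^ m / y ^ n) ^ q = x := by
      rw [div_pow, ← pow_mul, ← pow_mul, mul_comm n q, pow_mul y, ← hxy, ← pow_mul,
        mul_comm p n, hmn', pow_succ]
      exact mul_div_cancel_left₀ x (pow_ne_zero _ hx)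
    simp only [ne_eq, hy, not_false_eq_true, if_true]
    rw [← hab, pow_add, mul_comm a p, mul_comm b q, pow_mul, pow_mul, hpow_p, hpow_q]
end

section
/- Let p, q ≥ 2 be coprime integers. There is no function F : ℂ × ℂ → ℂ that is analytic at (0, 0) (AnalyticAt ℂ F (0,0)) and satisfies F(t^q, t^p) = t for all t in some neighborhood of 0 in ℂ. (Hence the function h on Γ = {z₁^p = z₂^q}, whose pullback under t ↦ (t^q, t^p) is the identity, is not holomorphic about (0, 0).) -/
/-- For coprime `p, q ≥ 2`, there is no function on `ℂ²` analytic at the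
origin whose pullback under the normalization `t ↦ (t^q, t^p)` equals the
identity near `0`; hence the function `h` on `{z₁^p = z₂^q}` is not
holomorphic about `(0, 0)`. -/
theorem no_analytic_extension_of_h (p q : ℕ) (hp : 2 ≤ p) (hq : 2 ≤ q)
    (hpq : Nat.Coprime p q) :
    ¬ ∃ F : ℂ × ℂ → ℂ, AnalyticAt ℂ F (0, 0) ∧
      ∀ᶠ t in nhds (0 : ℂ), F (t ^ q, t ^ p) = t := by
  rintro ⟨F, hF, h⟩
  have hpow (n : ℕ) (hn : 2 ≤ n) : HasDerivAt (fun t : ℂ => t ^ n) 0 0 := by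
    simpa [zero_pow (show n - 1 ≠ 0 by omega)] using hasDerivAt_pow n (0 : ℂ)
  have hdiff : HasFDerivAt F (fderiv ℂ F (0, 0)) ((0 : ℂ) ^ q, (0 : ℂ) ^ p) := by
    rw [zero_pow (by omega), zero_pow (by omega)]
    exact hF.differentiableAt.hasFDerivAt
  have hcomp : HasDerivAt (fun t : ℂ => F (t ^ q, t ^ p)) (fderiv ℂ F (0, 0) (0, 0)) 0 :=
    hdiff.comp_hasDerivAt (0 : ℂ) ((hpow q hq).prodMk (hpow p hp))
  have hid : HasDerivAt (fun t : ℂ => F (t ^ q, t ^ p)) 1 0 :=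
    (hasDerivAt_id (0 : ℂ)).congr_of_eventuallyEq h
  have hzero : fderiv ℂ F (0, 0) (0, 0) = 0 := map_zero _
  exact one_ne_zero ((hid.unique hcomp).trans hzero)
end

section
/- Let p, q ≥ 2 be coprime integers and let j be a natural number that does NOT belong to the additive submonoid of ℕ generated by p and q (i.e., j cannot be written as α·p + β·q with α, β ∈ ℕ). Then there is no function F : ℂ × ℂ → ℂ analytic at (0, 0) (AnalyticAt ℂ F (0,0)) such that F(t^q, t^p) = t^j for all t in some neighborhood of 0 in ℂ. -/
open Asymptotics Topology in
/-- Higher powers are dominated by lower powers at the origin. -/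
theorem Asymptotics.isBigO_pow_pow_nhds_zero {𝕜 : Type*} [NormedField 𝕜] {m n : ℕ}
    (h : m ≤ n) : (fun t : 𝕜 => t ^ n) =O[𝓝 0] fun t => t ^ m := by
  have hbdd : (fun t : 𝕜 => t ^ (n - m)) =O[𝓝 0] fun _ => (1 : 𝕜) :=
    ((continuous_pow (n - m)).tendsto 0).isBigO_one 𝕜
  simpa [← pow_add, Nat.sub_add_cancel h] using hbdd.mul (isBigO_refl (fun t : 𝕜 => t ^ m) _)

open Asymptotics Filter Topology in
/-- A polynomial over a normed field that is `O(t ^ n)` at the origin is divisible by `X ^ n`. -/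
theorem Polynomial.X_pow_dvd_of_isBigO {𝕜 : Type*} [NontriviallyNormedField 𝕜]
    (P : Polynomial 𝕜) (n : ℕ)
    (h : (fun t : 𝕜 => P.eval t) =O[𝓝 0] fun t => t ^ n) : Polynomial.X ^ n ∣ P := by
  induction n with
  | zero => simp
  | succ n ih =>
    obtain ⟨Q, rfl⟩ := ih (h.trans (isBigO_pow_pow_nhds_zero n.le_succ))
    have hQ : (fun t : 𝕜 => Q.eval t) =O[𝓝[≠] 0] fun t => t := by
      refine ((isBigO_refl (fun t : 𝕜 => (t ^ n)⁻¹) _).mul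
        (h.mono nhdsWithin_le_nhds)).congr' ?_ ?_ <;>
      · filter_upwards [self_mem_nhdsWithin] with t (ht : t ≠ 0)
        simp [pow_succ, ht]
    have hlim : Tendsto (fun t : 𝕜 => Q.eval t) (𝓝[≠] 0) (𝓝 0) :=
      hQ.trans_tendsto (tendsto_id.mono_left nhdsWithin_le_nhds)
    have h0 : Q.eval 0 = 0 :=
      tendsto_nhds_unique ((Q.continuous.tendsto 0).mono_left nhdsWithin_le_nhds) hlim
    rw [pow_succ]
    exact mul_dvd_mul_left _ (Polynomial.X_dvd_iff.mpr (Q.coeff_zero_eq_eval_zero.trans h0))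

/-- Restricting a homogeneous form on `𝕜 × 𝕜` to the curve `t ↦ (t ^ q, t ^ p)` gives a polynomial
whose exponents lie in the numerical semigroup generated by `p` and `q`. -/
theorem MultilinearMap.exists_polynomial_eval_eq_apply_monomial_curve {𝕜 : Type*} [Field 𝕜] {n : ℕ}
    (f : MultilinearMap 𝕜 (fun _ : Fin n => 𝕜 × 𝕜) 𝕜) (p q : ℕ) :
    ∃ P : Polynomial 𝕜, (∀ t, P.eval t = f fun _ => (t ^ q, t ^ p)) ∧
      ∀ j, j ∉ AddSubmonoid.closure {p, q} → P.coeff j = 0 := by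
  let e : Fin 2 → ℕ := ![q, p]
  let v : Fin 2 → 𝕜 × 𝕜 := ![(1, 0), (0, 1)]
  refine ⟨∑ r : Fin n → Fin 2, Polynomial.monomial (∑ i, e (r i)) (f fun i => v (r i)), ?_, ?_⟩
  · intro t
    have hv : (fun _ : Fin n => (t ^ q, t ^ p)) = fun _ => ∑ k, t ^ e k • v k := by
      simp [e, v]
    rw [hv, f.map_sum, Polynomial.eval_finsetSum]
    refine Finset.sum_congr rfl fun r _ => ?_
    rw [f.map_smul_univ (fun i => t ^ e (r i)), Finset.prod_pow_eq_pow_sum,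
      Polynomial.eval_monomial, smul_eq_mul, mul_comm]
  · intro j hj
    rw [Polynomial.finsetSum_coeff]
    refine Finset.sum_eq_zero fun r _ => Polynomial.coeff_monomial_of_ne _ ?_
    rintro rfl
    refine hj (AddSubmonoid.sum_mem _ fun i _ => AddSubmonoid.subset_closure ?_)
    generalize r i = k
    fin_cases k <;> simp [e]

open Asymptotics Filter Topology in
/-- The Taylor polynomial of an analytic function approximates its restriction to the curve
`t ↦ (t ^ q, t ^ p)`. -/
theorem HasFPowerSeriesAt.isBigO_monomial_curve_sub_partialSum {𝕜 : Type*}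
    [NontriviallyNormedField 𝕜] {F : 𝕜 × 𝕜 → 𝕜} {φ : FormalMultilinearSeries 𝕜 (𝕜 × 𝕜) 𝕜}
    (hF : HasFPowerSeriesAt F φ (0, 0)) {p q : ℕ} (hp : p ≠ 0) (hq : q ≠ 0) (n : ℕ) :
    (fun t : 𝕜 => F (t ^ q, t ^ p) - φ.partialSum n (t ^ q, t ^ p)) =O[𝓝 0] fun t => t ^ n := by
  have hpow (m : ℕ) (hm : m ≠ 0) : (fun t : 𝕜 => t ^ m) =O[𝓝 0] fun t => t := by
    simpa using isBigO_pow_pow_nhds_zero (𝕜 := 𝕜) (Nat.one_le_iff_ne_zero.mpr hm)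
  have hcurve : Tendsto (fun t : 𝕜 => (t ^ q, t ^ p)) (𝓝 0) (𝓝 0) := by
    have : Continuous fun t : 𝕜 => (t ^ q, t ^ p) := by fun_prop
    simpa [hp, hq, Prod.zero_eq_mk] using this.tendsto 0
  have h := (hF.isBigO_sub_partialSum_pow n).comp_tendsto hcurve
  have h' : (fun t : 𝕜 => ‖(t ^ q, t ^ p)‖ ^ n) =O[𝓝 0] fun t => t ^ n :=
    ((hpow q hq).prod_left (hpow p hp)).norm_left.pow n
  simpa [Function.comp_def] using h.trans h'


/-- For coprime `p, q ≥ 2` and a natural number `j` not in the numerical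
semigroup generated by `p` and `q`, there is no function on `ℂ²` analytic at
the origin whose pullback under the normalization `t ↦ (t^q, t^p)` equals
`t ↦ t^j` near `0`. -/
theorem no_analytic_extension_of_monomial (p q j : ℕ) (hp : 2 ≤ p)
    (hq : 2 ≤ q) (hpq : Nat.Coprime p q)
    (hj : ¬ ∃ α β : ℕ, j = α * p + β * q) :
    ¬ ∃ F : ℂ × ℂ → ℂ, AnalyticAt ℂ F (0, 0) ∧
      ∀ᶠ t in nhds (0 : ℂ), F (t ^ q, t ^ p) = t ^ j := by
  rintro ⟨F, ⟨φ, hφ⟩, hF⟩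
  have hj' : j ∉ AddSubmonoid.closure {p, q} := fun h => by
    obtain ⟨α, β, h⟩ := AddSubmonoid.mem_closure_pair p q j |>.mp h
    exact hj ⟨α, β, by simpa using h.symm⟩
  choose P hPeval hPcoeff using fun n =>
    (φ n).toMultilinearMap.exists_polynomial_eval_eq_apply_monomial_curve p q
  let R : Polynomial ℂ := Polynomial.X ^ j - ∑ n ∈ Finset.range (j + 1), P n
  have hR : Polynomial.X ^ (j + 1) ∣ R := by
    refine R.X_pow_dvd_of_isBigO _ ((hφ.isBigO_monomial_curve_sub_partialSum
      (by lia : p ≠ 0) (by lia : q ≠ 0) (j + 1)).congr' ?_ .rfl)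
    filter_upwards [hF] with t ht
    simp [R, ht, Polynomial.eval_finsetSum, hPeval, FormalMultilinearSeries.partialSum]
  have hzero : R.coeff j = 0 := Polynomial.X_pow_dvd_iff.mp hR j j.lt_succ_self
  simp [R, Polynomial.finsetSum_coeff, hPcoeff _ j hj'] at hzero
end

section
/- Let p, q ≥ 2 be coprime integers and let m, n be natural numbers with m·q − n·p = 1. Let a, b be natural numbers such that q·⌊(m + a)/p⌋ + b ≥ n, where ⌊·⌋ denotes the floor (natural number division). Then there exist natural numbers α, β with a·q + b·p + 1 = α·p + β·q, and consequently, for every (z₁, z₂) ∈ ℂ × ℂ with z₁^p = z₂^q, one has z₁^a · z₂^b · h(z₁, z₂) = z₂^α · z₁^β, where h(z₁, z₂) = z₁^m / z₂^n if z₂ ≠ 0 and h(z₁, z₂) = 0 if z₂ = 0. In particular z₁^a z₂^b h is holomorphic on Γ. -/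
/-- For coprime `p, q ≥ 2`, naturals `m, n` with `m·q − n·p = 1`, and naturals
`a, b` with `q·⌊(m+a)/p⌋ + b ≥ n`, the exponent `a·q + b·p + 1` lies in the
numerical semigroup generated by `p` and `q`, and consequently
`z₁^a · z₂^b · h` coincides on the cusp curve `{z₁^p = z₂^q}` with the
polynomial `z₂^α · z₁^β`; in particular `z₁^a z₂^b h` is holomorphic on the
curve. -/
theorem monomial_times_h_holomorphic (p q m n a b : ℕ) (hp : 2 ≤ p)
    (hq : 2 ≤ q) (hpq : Nat.Coprime p q)
    (hmn : (m : ℤ) * q - (n : ℤ) * p = 1)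
    (hab : n ≤ q * ((m + a) / p) + b)
    (h : ℂ × ℂ → ℂ)
    (hdef : ∀ z : ℂ × ℂ, h z = if z.2 ≠ 0 then z.1 ^ m / z.2 ^ n else 0) :
    ∃ α β : ℕ, a * q + b * p + 1 = α * p + β * q ∧
      ∀ z : ℂ × ℂ, z.1 ^ p = z.2 ^ q →
        z.1 ^ a * z.2 ^ b * h z = z.2 ^ α * z.1 ^ β := by
  obtain ⟨α, hα⟩ := Nat.exists_eq_add_of_le hab
  have hdiv : p * ((m + a) / p) + (m + a) % p = m + a := Nat.div_add_mod (m + a) p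
  generalize (m + a) / p = k at hα hdiv
  generalize (m + a) % p = β at hdiv
  have hexp : a * q + b * p + 1 = α * p + β * q := by
    zify at hα hdiv ⊢
    linear_combination p * hα - q * hdiv - hmn
  refine ⟨α, β, hexp, fun z hz => ?_⟩
  rw [hdef]
  split_ifs with hz₂
  · have hz₁ : z.1 ^ a * z.1 ^ m = z.2 ^ (q * k) * z.1 ^ β := by
      rw [← pow_add, add_comm a m, ← hdiv, pow_add, pow_mul, hz, ← pow_mul]
    have hz₂' : z.2 ^ (q * k) * z.2 ^ b = z.2 ^ n * z.2 ^ α := by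
      rw [← pow_add, hα, pow_add]
    field_simp
    linear_combination z.2 ^ b * hz₁ + z.1 ^ β * hz₂'
  · have hz₂' : z.2 = 0 := not_not.mp hz₂
    have hz₁ : z.1 = 0 := by
      rw [hz₂', zero_pow (by omega)] at hz
      exact eq_zero_of_pow_eq_zero hz
    have hαβ : α + β ≠ 0 := by
      intro h0
      obtain ⟨rfl, rfl⟩ := Nat.add_eq_zero_iff.mp h0
      simp at hexp
    rw [hz₁, hz₂', mul_zero, ← pow_add, zero_pow hαβ]
end

section
/- Let p, q ≥ 2 be coprime integers, let S = {(z₁, z₂) ∈ ℂ × ℂ : z₁^p = z₂^q}, and let f : ℂ × ℂ → ℂ be continuous on S. Say that f is holomorphic relative to S at x ∈ S if there exists F : ℂ × ℂ → ℂ with AnalyticAt ℂ F x such that F agrees with f on S in some neighborhood of x. Assume that f is holomorphic relative to S at every point x ∈ S with f(x) ≠ 0. Then for every natural number n with n ≥ (p − 1)·(q − 1), the power f^n is holomorphic relative to S at every point of S. -/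
/-- `f` is holomorphic relative to `S` at `x`: it agrees with some function
analytic at `x` on `S` in a neighborhood of `x`. -/
def HolomorphicRelAt (S : Set (ℂ × ℂ)) (f : ℂ × ℂ → ℂ) (x : ℂ × ℂ) : Prop :=
  ∃ F : ℂ × ℂ → ℂ, AnalyticAt ℂ F x ∧
    ∃ V ∈ nhds x, ∀ z ∈ V ∩ S, F z = f z

open Complex Metric Set Filter Topology

theorem norm_le_of_differentiableAt_off_zeros {g h : ℂ → ℂ} (hg : Continuous g)
    (hgd : ∀ z, g z ≠ 0 → DifferentiableAt ℂ g z) (hh : Continuous h)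
    (hhd : ∀ z, g z ≠ 0 → DifferentiableAt ℂ h z) {c w : ℂ} {R M : ℝ}
    (hM : ∀ z ∈ sphere c R, ‖h z‖ ≤ M) (hw : w ∈ ball c R) (hgw : g w ≠ 0) : ‖h w‖ ≤ M := by
  obtain ⟨A, hA⟩ := (isCompact_closedBall c R).exists_bound_of_continuousOn hg.continuousOn
  have hU : IsOpen ({z | g z ≠ 0} ∩ ball c R) := (hg.isOpen_preimage _ isOpen_ne).inter isOpen_ball
  have hR : 0 < R := pos_of_mem_ball hw
  have hM0 : 0 ≤ M := by
    obtain ⟨z, hz⟩ := (NormedSpace.sphere_nonempty (x := c)).2 hR.le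
    exact (norm_nonneg _).trans (hM z hz)
  have hA0 : 0 ≤ A := (norm_nonneg _).trans (hA w (ball_subset_closedBall hw))
  have key (n : ℕ) : ‖g w‖ * ‖h w‖ ^ n ≤ A * M ^ n := by
    rw [← norm_pow, ← norm_mul]
    refine norm_le_of_forall_mem_frontier_norm_le (f := fun z => g z * h z ^ n)
      (isBounded_ball.subset inter_subset_right) ⟨fun z hz => ?_, by fun_prop⟩ (fun z hz => ?_)
      (subset_closure (show w ∈ {z | g z ≠ 0} ∩ ball c R from ⟨hgw, hw⟩))
    · exact ((hgd z hz.1).mul ((hhd z hz.1).pow n)).differentiableWithinAt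
    · rw [frontier, hU.interior_eq] at hz
      have hzc : z ∈ closedBall c R :=
        closure_ball_subset_closedBall (closure_mono inter_subset_right hz.1)
      by_cases h0 : g z = 0
      · simp only [h0, zero_mul, norm_zero]
        positivity
      · have hzs : z ∈ sphere c R := by
          by_contra hcon
          exact hz.2 ⟨h0, lt_of_le_of_ne hzc hcon⟩
        rw [norm_mul, norm_pow]
        gcongr
        exacts [hA z hzc, hM z hzs]
  by_contra! hlt
  have hpos : 0 < ‖h w‖ := hM0.trans_lt hlt
  have hlim : Tendsto (fun n : ℕ => A * (M / ‖h w‖) ^ n) atTop (𝓝 (A * 0)) :=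
    (tendsto_pow_atTop_nhds_zero_of_lt_one (by positivity) ((div_lt_one hpos).2 hlt)).const_mul A
  have hle : ‖g w‖ ≤ A * 0 := ge_of_tendsto' hlim fun n => by
    rw [div_pow, ← mul_div_assoc, le_div_iff₀ (by positivity)]
    exact key n
  rw [mul_zero] at hle
  exact hgw (norm_le_zero_iff.1 hle)

theorem re_le_of_differentiableAt_off_zeros {g h : ℂ → ℂ} (hg : Continuous g)
    (hgd : ∀ z, g z ≠ 0 → DifferentiableAt ℂ g z) (hh : Continuous h)
    (hhd : ∀ z, g z ≠ 0 → DifferentiableAt ℂ h z) {c w : ℂ} {R M : ℝ}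
    (hM : ∀ z ∈ sphere c R, (h z).re ≤ M) (hw : w ∈ ball c R) (hgw : g w ≠ 0) :
    (h w).re ≤ M := by
  rw [← Real.exp_le_exp, ← Complex.norm_exp]
  refine norm_le_of_differentiableAt_off_zeros (h := fun z => Complex.exp (h z)) hg hgd
    (by fun_prop) (fun z hz => (hhd z hz).cexp) (fun z hz => ?_) hw hgw
  rw [Complex.norm_exp, Real.exp_le_exp]
  exact hM z hz

/-- On a circle, the real part of a continuous function is uniformly approximated by real parts of
entire functions. -/
theorem exists_differentiable_abs_re_sub_re_le {h : ℂ → ℂ} (hh : Continuous h) (c : ℂ) {R ε : ℝ}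
    (hR : 0 < R) (hε : 0 < ε) :
    ∃ p : ℂ → ℂ, Differentiable ℂ p ∧ ∀ z ∈ sphere c R, |(h z).re - (p z).re| ≤ ε := by
  have : Fact (0 < 2 * Real.pi) := ⟨Real.two_pi_pos⟩
  let e : AddCircle (2 * Real.pi) → ℂ := fun x => c + R * (AddCircle.toCircle x : ℂ)
  have he : Continuous e := by
    have := AddCircle.continuous_toCircle (T := 2 * Real.pi)
    fun_prop
  let H : C(AddCircle (2 * Real.pi), ℂ) := ⟨fun x => h (e x), hh.comp he⟩
  have hH : H ∈ (Submodule.span ℂ (range (@fourier (2 * Real.pi)))).topologicalClosure := by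
    rw [span_fourier_closure_eq_top]; trivial
  obtain ⟨q, hq, hqH⟩ := Metric.mem_closure_iff.1 hH ε hε
  have hspan : ∀ a : ℂ, ∃ p : ℂ → ℂ, Differentiable ℂ p ∧
      ∀ x, (p (e x)).re = (a * q x).re := by
    have hR' : (R : ℂ) ≠ 0 := by exact_mod_cast hR.ne'
    have heR (x) : (e x - c) / R = AddCircle.toCircle x := by simp [e, hR']
    clear hqH
    have hfour (n : ℤ) (x : AddCircle (2 * Real.pi)) :
        fourier n x = (AddCircle.toCircle x : ℂ) ^ n := by
      rw [fourier_apply, AddCircle.toCircle_zsmul]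
      exact Circle.coe_zpow _ _
    induction hq using Submodule.span_induction with
    | mem q hq =>
      obtain ⟨n, rfl⟩ := hq
      intro a
      obtain ⟨m, rfl | rfl⟩ := n.eq_nat_or_neg
      · refine ⟨fun z => a * ((z - c) / R) ^ m, by fun_prop, fun x => ?_⟩
        simp only [heR, hfour, zpow_natCast]
      · refine ⟨fun z => (starRingEnd ℂ) a * ((z - c) / R) ^ m, by fun_prop, fun x => ?_⟩
        simp only [heR, hfour, zpow_neg, zpow_natCast]
        rw [← Complex.conj_re, map_mul, map_pow, Complex.conj_conj, ← Circle.coe_inv_eq_conj,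
          Circle.coe_inv, inv_pow]
    | zero => exact fun a => ⟨0, by fun_prop, by simp⟩
    | add x y _ _ hx hy =>
      intro a
      obtain ⟨p₁, hp₁, h₁⟩ := hx a
      obtain ⟨p₂, hp₂, h₂⟩ := hy a
      exact ⟨p₁ + p₂, hp₁.add hp₂, fun t => by
        simp only [Pi.add_apply, ContinuousMap.add_apply, mul_add, add_re, h₁, h₂]⟩
    | smul b x _ hx =>
      intro a
      obtain ⟨p, hp, h⟩ := hx (a * b)
      exact ⟨p, hp, fun t => by simp only [h, ContinuousMap.smul_apply, smul_eq_mul, mul_assoc]⟩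
  obtain ⟨p, hp, hpq⟩ := hspan 1
  refine ⟨p, hp, fun z hz => ?_⟩
  obtain ⟨x, rfl⟩ : ∃ x, e x = z := by
    have : z ∈ range (circleMap c R) := by rwa [range_circleMap, abs_of_pos hR]
    obtain ⟨θ, rfl⟩ := this
    refine ⟨(θ : AddCircle (2 * Real.pi)), ?_⟩
    simp [e, circleMap, AddCircle.toCircle, Real.pi_ne_zero]
  rw [hpq, one_mul, ← sub_re]
  refine (abs_re_le_norm _).trans ?_
  rw [← dist_eq_norm]
  exact (ContinuousMap.dist_apply_le_dist (f := H) (g := q) x).trans hqH.le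

theorem circleAverage_eq_of_differentiableAt_off_zeros {g h : ℂ → ℂ} (hg : Continuous g)
    (hgd : ∀ z, g z ≠ 0 → DifferentiableAt ℂ g z) (hh : Continuous h)
    (hhd : ∀ z, g z ≠ 0 → DifferentiableAt ℂ h z) {c : ℂ} {R : ℝ} (hR : 0 < R) (hgc : g c ≠ 0) :
    Real.circleAverage h c R = h c := by
  have hre : ∀ h : ℂ → ℂ, Continuous h → (∀ z, g z ≠ 0 → DifferentiableAt ℂ h z) →
      (Real.circleAverage h c R).re = (h c).re := by
    intro h hh hhd
    have hc : c ∈ ball c R := mem_ball_self hR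
    have havg (k : ℂ → ℂ) (hk : Continuous k) :
        Real.circleAverage (fun z => (k z).re) c R = (Real.circleAverage k c R).re :=
      reCLM.circleAverage_comp_comm hk.continuousOn.circleIntegrable'
    refine eq_of_abs_sub_le_all fun ε hε => ?_
    obtain ⟨p, hp, hhp⟩ := exists_differentiable_abs_re_sub_re_le hh c hR (half_pos hε)
    have h₁ : (h c).re - (p c).re ≤ ε / 2 :=
      re_le_of_differentiableAt_off_zeros (h := fun z => h z - p z) hg hgd
        (hh.sub hp.continuous) (fun z hz => (hhd z hz).sub (hp z))
        (fun z hz => (abs_le.1 (hhp z hz)).2) hc hgc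
    have h₂ : (p c).re - (h c).re ≤ ε / 2 :=
      re_le_of_differentiableAt_off_zeros (h := fun z => p z - h z) hg hgd
        (hp.continuous.sub hh) (fun z hz => (hp z).sub (hhd z hz))
        (fun z hz => by have := (abs_le.1 (hhp z hz)).1; rw [sub_re]; linarith) hc hgc
    have h₃ : |(Real.circleAverage (fun z => h z - p z) c R).re| ≤ ε / 2 := by
      have hcont : Continuous fun z => h z - p z := hh.sub hp.continuous
      rw [← havg _ hcont]
      refine Real.abs_circleAverage_le_circleAverage_abs.trans ?_
      refine Real.circleAverage_mono_on_of_le_circle ?_ fun z hz => ?_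
      · exact (continuous_re.comp hcont).abs.continuousOn.circleIntegrable'
      · rw [abs_of_pos hR] at hz
        exact hhp z hz
    rw [Real.circleAverage_fun_sub hh.continuousOn.circleIntegrable'
      hp.continuous.continuousOn.circleIntegrable', hp.diffContOnCl.circleAverage, sub_re] at h₃
    rw [abs_le] at h₃ ⊢
    constructor <;> linarith [h₃.1, h₃.2]
  refine Complex.ext (hre h hh hhd) ?_
  have := hre (fun z => (-I) • h z) (by fun_prop) fun z hz => (hhd z hz).fun_const_smul _
  rw [Real.circleAverage_fun_smul] at this
  simpa using this

theorem cauchy_integral_eq_of_differentiableAt_off_zeros {g : ℂ → ℂ} (hg : Continuous g)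
    (hgd : ∀ z, g z ≠ 0 → DifferentiableAt ℂ g z) {c w : ℂ} {R : ℝ} (hgc : g c ≠ 0)
    (hw : w ∈ ball c R) (hgw : g w ≠ 0) :
    (2 * Real.pi * I : ℂ)⁻¹ • ∮ z in C(c, R), (z - w)⁻¹ • g z = g w := by
  have hR : 0 < R := pos_of_mem_ball hw
  have hΩ : IsOpen {z | g z ≠ 0} := hg.isOpen_preimage _ isOpen_ne
  have hds : Continuous (dslope g w) := by
    rw [← continuousOn_univ, continuousOn_dslope univ_mem]
    exact ⟨hg.continuousOn, hgd w hgw⟩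
  have hdd : ∀ z, g z ≠ 0 → DifferentiableAt ℂ (dslope g w) z := fun z hz =>
    ((differentiableOn_dslope (hΩ.mem_nhds hgw)).2
      fun x hx => (hgd x hx).differentiableWithinAt).differentiableAt (hΩ.mem_nhds hz)
  have havg := circleAverage_eq_of_differentiableAt_off_zeros
    (h := fun z => (z - c) * dslope g w z) hg hgd
    (by fun_prop) (fun z hz => by have := hdd z hz; fun_prop) hR hgc
  have hne : ∀ z ∈ sphere c R, z - w ≠ 0 := fun z hz h0 => by
    rw [sub_eq_zero.1 h0] at hz
    exact hw.ne hz
  have hcont : ContinuousOn (fun z => (z - w)⁻¹) (sphere c R) :=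
    (by fun_prop : Continuous fun z : ℂ => z - w).continuousOn.inv₀ hne
  have hint₁ : CircleIntegrable (fun z => (z - w)⁻¹ • g z) c R :=
    (hcont.smul hg.continuousOn).circleIntegrable hR.le
  have hint₂ : CircleIntegrable (fun z => (z - w)⁻¹ • g w) c R :=
    (hcont.smul continuousOn_const).circleIntegrable hR.le
  rw [Real.circleAverage_eq_circleIntegral hR.ne', sub_self, zero_mul,
    circleIntegral.integral_congr (g := fun z => (z - w)⁻¹ • g z - (z - w)⁻¹ • g w) hR.le
      (fun z hz => ?_),
    circleIntegral.integral_sub hint₁ hint₂,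
    smul_sub, sub_eq_zero] at havg
  · rw [havg, circleIntegral.integral_smul_const,
      circleIntegral.integral_sub_inv_of_mem_ball hw, inv_smul_smul₀ two_pi_I_ne_zero]
  · have hzc : z - c ≠ 0 := sub_ne_zero.2 (ne_of_mem_sphere hz hR.ne')
    have h1 := sub_smul_dslope g w z
    have h2 := hne z hz
    simp only [smul_eq_mul] at h1 ⊢
    rw [← mul_sub, ← h1]
    field_simp

theorem isPreconnected_ball_diff_center (b : ℂ) (r : ℝ) : IsPreconnected (ball b r \ {b}) := by
  have hpre : IsPreconnected ((fun z => b + Complex.exp z) '' {z : ℂ | z.re < Real.log r}) :=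
    ((convex_halfSpace_re_lt (Real.log r)).isPreconnected).image _ (by fun_prop)
  rcases le_or_gt r 0 with hr | hr
  · simp [ball_eq_empty.2 hr, isPreconnected_empty]
  convert! hpre using 1
  ext z
  constructor
  · rintro ⟨hz, hzb⟩
    have h0 : z - b ≠ 0 := sub_ne_zero.2 hzb
    refine ⟨Complex.log (z - b), ?_, by simp [Complex.exp_log h0]⟩
    rw [mem_ball, dist_eq_norm] at hz
    simpa [Complex.log_re] using Real.log_lt_log (norm_pos_iff.2 h0) hz
  · rintro ⟨u, hu, rfl⟩
    refine ⟨?_, by simp⟩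
    simpa [Complex.norm_exp, dist_eq_norm] using (Real.lt_log_iff_exp_lt hr).1 hu

/-- **Radó's theorem**: a continuous function on the plane that is holomorphic off its zero set
is entire. -/
theorem differentiable_of_differentiableAt_off_zeros {g : ℂ → ℂ} (hg : Continuous g)
    (hgd : ∀ z, g z ≠ 0 → DifferentiableAt ℂ g z) : Differentiable ℂ g := by
  intro b
  have hΩ : IsOpen {z | g z ≠ 0} := hg.isOpen_preimage _ isOpen_ne
  by_cases hgb : g b = 0
  swap
  · exact hgd b hgb
  by_cases hb : b ∈ closure {z | g z ≠ 0}
  swap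
  · have : g =ᶠ[𝓝 b] fun _ => 0 := by
      filter_upwards [isClosed_closure.isOpen_compl.mem_nhds hb] with z hz
      by_contra h
      exact hz (subset_closure h)
    exact (differentiableAt_const (0 : ℂ)).congr_of_eventuallyEq this
  obtain ⟨c, hc⟩ : {z | g z ≠ 0}.Nonempty := closure_nonempty_iff.1 ⟨b, hb⟩
  let R : NNReal := ⟨dist b c + 1, by positivity⟩
  have hR : 0 < R := by
    rw [← NNReal.coe_pos]
    show 0 < dist b c + 1
    positivity
  have hbR : b ∈ ball c (R : ℝ) := by
    rw [mem_ball]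
    show dist b c < dist b c + 1
    linarith
  let F : ℂ → ℂ := fun w => (2 * Real.pi * I : ℂ)⁻¹ • ∮ z in C(c, R), (z - w)⁻¹ • g z
  have hF : DifferentiableOn ℂ F (ball c R) := by
    have := (hasFPowerSeriesOn_cauchy_integral (c := c)
      (hg.continuousOn.circleIntegrable R.2) hR).differentiableOn
    rwa [Metric.eball_coe] at this
  have hFg : ∀ w ∈ ball c (R : ℝ), g w ≠ 0 → F w = g w := fun w hw hgw =>
    cauchy_integral_eq_of_differentiableAt_off_zeros hg hgd hc hw hgw
  have hFcl : ∀ w ∈ ball c (R : ℝ), w ∈ closure {z | g z ≠ 0} → F w = g w := by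
    have : EqOn F g (ball c R ∩ {z | g z ≠ 0}) := fun w hw => hFg w hw.1 hw.2
    intro w hw hwcl
    exact this.of_subset_closure (hF.continuousOn.mono inter_subset_left) hg.continuousOn
      (inter_subset_inter_right _ subset_closure) isOpen_ball.inter_closure ⟨hw, hwcl⟩
  have hFa : AnalyticAt ℂ F b := hF.analyticAt (isOpen_ball.mem_nhds hbR)
  have hne : ∀ᶠ z in 𝓝[≠] b, F z ≠ 0 := by
    refine hFa.eventually_eq_zero_or_eventually_ne_zero.resolve_left fun h => ?_
    obtain ⟨z, hz, hgz⟩ := mem_closure_iff_nhds.1 hb _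
      (inter_mem h (isOpen_ball.mem_nhds hbR))
    exact hgz ((hFg z hz.2 hgz).symm.trans hz.1)
  obtain ⟨r, hr, hrsub⟩ : ∃ r > 0, ball b r ⊆ {z | z ∈ ball c (R : ℝ) ∧ (z ≠ b → F z ≠ 0)} := by
    refine Metric.mem_nhds_iff.1 (inter_mem (isOpen_ball.mem_nhds hbR) ?_)
    exact eventually_nhdsWithin_iff.1 hne
  have hsub : ball b r \ {b} ⊆ {z | g z ≠ 0} := by
    refine (isPreconnected_ball_diff_center b r).subset_left_of_subset_union hΩ
      isClosed_closure.isOpen_compl (disjoint_compl_right.mono_left subset_closure) ?_ ?_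
    · intro z hz
      by_cases hzcl : z ∈ closure {z | g z ≠ 0}
      · left
        have := hrsub hz.1
        exact fun h0 => this.2 hz.2 ((hFcl z this.1 hzcl).trans h0)
      · exact Or.inr hzcl
    · obtain ⟨z, hz, hgz⟩ := mem_closure_iff_nhds.1 hb _ (ball_mem_nhds b hr)
      exact ⟨z, ⟨hz, fun h => hgz (by rw [mem_singleton_iff.1 h, hgb])⟩, hgz⟩
  refine hFa.differentiableAt.congr_of_eventuallyEq ?_
  filter_upwards [ball_mem_nhds b hr] with z hz
  refine (hFcl z (hrsub hz).1 ?_).symm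
  by_cases hzb : z = b
  · rwa [hzb]
  · exact subset_closure (hsub ⟨hz, hzb⟩)

/-- An entire function splits along the residue classes of the exponents of its Taylor series. -/
theorem exists_differentiable_eq_sum_pow_mul_comp_pow {h : ℂ → ℂ} (hh : Differentiable ℂ h)
    (N : ℕ) [NeZero N] :
    ∃ H : ZMod N → ℂ → ℂ, (∀ j, Differentiable ℂ (H j)) ∧
      ∀ t, h t = ∑ j, t ^ j.val * H j (t ^ N) := by
  obtain ⟨a, ha⟩ : ∃ a : ℕ → ℂ, ∀ t, HasSum (fun n => a n * t ^ n) (h t) := by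
    refine ⟨fun n => (n.factorial : ℂ)⁻¹ * iteratedDeriv n h 0, fun t => ?_⟩
    have := hasSum_taylorSeries_of_entire hh 0 t
    simp only [sub_zero, smul_eq_mul] at this
    simpa only [mul_assoc, mul_comm (t ^ _)] using this
  refine ⟨fun j s => ∑' m, a (j.val + N * m) * s ^ m, fun j s => ?_, fun t => ?_⟩
  · set ρ : ℝ := ‖s‖ + 1 with hρ
    have hρ1 : 1 ≤ ρ := by simp [hρ]
    have hinj : Function.Injective fun m : ℕ => j.val + N * m := fun x y hxy =>
      Nat.eq_of_mul_eq_mul_left (NeZero.pos N) (Nat.add_left_cancel hxy)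
    have hsum : Summable fun m : ℕ => ‖a (j.val + N * m) * (ρ : ℂ) ^ (j.val + N * m)‖ :=
      (ha ρ).summable.norm.comp_injective hinj
    refine (differentiableOn_tsum_of_summable_norm (U := ball 0 ρ) hsum (fun m => by fun_prop)
      isOpen_ball fun m w hw => ?_).differentiableAt (isOpen_ball.mem_nhds (by simp [hρ]))
    rw [mem_ball_zero_iff] at hw
    rw [norm_mul, norm_mul, norm_pow, norm_pow, Complex.norm_of_nonneg (by positivity)]
    gcongr
    calc ‖w‖ ^ m ≤ ρ ^ m := by gcongr
      _ ≤ ρ ^ (j.val + N * m) := pow_le_pow_right₀ hρ1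
          ((Nat.le_mul_of_pos_left m (NeZero.pos N)).trans (Nat.le_add_left _ _))
  · rw [← (ha t).tsum_eq, Nat.sumByResidueClasses (ha t).summable N]
    refine Finset.sum_congr rfl fun j _ => ?_
    rw [← tsum_mul_left]
    refine tsum_congr fun m => ?_
    rw [pow_add, pow_mul]
    ring

/-- Every integer above the Frobenius number of the coprime pair `p, q` is a combination of `p`
and `q` with natural coefficients. -/
theorem exists_mul_add_mul_eq_of_coprime {p q : ℕ} (hp : 2 ≤ p) (hq : 2 ≤ q)
    (hpq : Nat.Coprime p q) {k : ℕ} (hk : (p - 1) * (q - 1) ≤ k) :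
    ∃ α β : ℕ, q * α + p * β = k := by
  have hk' : p * q - p - q < k := by
    obtain ⟨p, rfl⟩ := Nat.exists_eq_add_of_le hp
    obtain ⟨q, rfl⟩ := Nat.exists_eq_add_of_le hq
    have h1 : 2 + p - 1 = p + 1 := by omega
    have h2 : 2 + q - 1 = q + 1 := by omega
    rw [h1, h2] at hk
    have h3 : (2 + p) * (2 + q) = (p + 1) * (q + 1) + (2 + p) + (1 + q) := by ring
    have h4 : 0 < (p + 1) * (q + 1) := by positivity
    omega
  obtain ⟨x, y, hxy⟩ := (AddSubmonoid.mem_closure_pair _ _ _).1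
    ((frobeniusNumber_iff.1 (frobeniusNumber_pair hpq hp hq)).2 k hk')
  exact ⟨y, x, by rw [← hxy, smul_eq_mul, smul_eq_mul]; ring⟩

/-- A global inverse of the normalization `t ↦ (t ^ q, t ^ p)` of the cusp curve off the origin. -/
theorem exists_zpow_mul_zpow_of_coprime {p q : ℕ} (hpq : Nat.Coprime p q) :
    ∃ a b : ℤ, (∀ t : ℂ, t ≠ 0 → (t ^ q) ^ a * (t ^ p) ^ b = t) ∧
      ∀ z : ℂ × ℂ, z.1 ≠ 0 → z.2 ≠ 0 → z.1 ^ p = z.2 ^ q →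
        (z.1 ^ a * z.2 ^ b) ^ q = z.1 ∧ (z.1 ^ a * z.2 ^ b) ^ p = z.2 := by
  have hbez : (q : ℤ) * q.gcdA p + p * q.gcdB p = 1 := by
    rw [← Nat.gcd_eq_gcd_ab, hpq.symm.gcd_eq_one, Nat.cast_one]
  refine ⟨q.gcdA p, q.gcdB p, fun t ht => ?_, fun z h1 h2 hz => ⟨?_, ?_⟩⟩
  · rw [← zpow_natCast, ← zpow_natCast, ← zpow_mul, ← zpow_mul, ← zpow_add₀ ht, hbez, zpow_one]
  all_goals
    have hz' : z.1 ^ (p : ℤ) = z.2 ^ (q : ℤ) := by simpa using hz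
    rw [mul_pow, ← zpow_natCast, ← zpow_natCast, ← zpow_mul, ← zpow_mul]
  · rw [mul_comm (q.gcdB p), zpow_mul z.2, ← hz', ← zpow_mul, ← zpow_add₀ h1, mul_comm _ (q : ℤ),
      hbez, zpow_one]
  · rw [mul_comm (q.gcdA p), zpow_mul z.1, hz', ← zpow_mul, ← zpow_add₀ h2, mul_comm _ (p : ℤ),
      hbez, zpow_one]

theorem exists_eq_pow_pow_of_mem_cusp {p q : ℕ} (hp : p ≠ 0) (hq : q ≠ 0)
    (hpq : Nat.Coprime p q) {z : ℂ × ℂ} (hz : z.1 ^ p = z.2 ^ q) : ∃ t : ℂ, z = (t ^ q, t ^ p) := by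
  by_cases h1 : z.1 = 0
  · refine ⟨0, Prod.ext (by simp [h1, hq]) ?_⟩
    rw [h1, zero_pow hp] at hz
    simpa [hp] using eq_zero_of_pow_eq_zero hz.symm
  · have h2 : z.2 ≠ 0 := fun h2 => by
      rw [h2, zero_pow hq] at hz
      exact h1 (eq_zero_of_pow_eq_zero hz)
    obtain ⟨a, b, -, hab⟩ := exists_zpow_mul_zpow_of_coprime hpq
    obtain ⟨e1, e2⟩ := hab z h1 h2 hz
    exact ⟨z.1 ^ a * z.2 ^ b, Prod.ext e1.symm e2.symm⟩

theorem differentiable_comp_normalization_of_cusp {p q : ℕ} {f : ℂ × ℂ → ℂ}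
    (hf : ContinuousOn f {z : ℂ × ℂ | z.1 ^ p = z.2 ^ q})
    (hol : ∀ x ∈ {z : ℂ × ℂ | z.1 ^ p = z.2 ^ q}, f x ≠ 0 →
      HolomorphicRelAt {z : ℂ × ℂ | z.1 ^ p = z.2 ^ q} f x) :
    Differentiable ℂ fun t : ℂ => f (t ^ q, t ^ p) := by
  have hmem (t : ℂ) : (t ^ q, t ^ p) ∈ {z : ℂ × ℂ | z.1 ^ p = z.2 ^ q} := by
    simp only [mem_ofPred_eq]
    rw [← pow_mul, ← pow_mul, mul_comm]
  have hπ : Differentiable ℂ fun t : ℂ => (t ^ q, t ^ p) := by fun_prop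
  refine differentiable_of_differentiableAt_off_zeros (hf.comp_continuous hπ.continuous hmem)
    fun t ht => ?_
  obtain ⟨F, hF, V, hV, hFf⟩ := hol _ (hmem t) ht
  have hcomp : DifferentiableAt ℂ (fun t : ℂ => F (t ^ q, t ^ p)) t :=
    DifferentiableAt.comp t (f := fun t : ℂ => (t ^ q, t ^ p)) hF.differentiableAt (hπ t)
  refine hcomp.congr_of_eventuallyEq ?_
  filter_upwards [hπ.continuous.continuousAt.preimage_mem_nhds hV] with s hs
  exact (hFf _ ⟨hs, hmem s⟩).symm

/-- An entire function divisible by a power of `t` beyond the conductor is the pullback of an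
analytic function under the normalization `t ↦ (t ^ q, t ^ p)`. -/
theorem exists_analyticAt_comp_eq_pow_mul {p q : ℕ} (hp : 2 ≤ p) (hq : 2 ≤ q)
    (hpq : Nat.Coprime p q) {n : ℕ} (hn : (p - 1) * (q - 1) ≤ n) {h : ℂ → ℂ}
    (hh : Differentiable ℂ h) :
    ∃ F : ℂ × ℂ → ℂ, (∀ z, AnalyticAt ℂ F z) ∧ ∀ t, F (t ^ q, t ^ p) = t ^ n * h t := by
  have : NeZero p := ⟨by omega⟩
  obtain ⟨H, hH, hHh⟩ := exists_differentiable_eq_sum_pow_mul_comp_pow hh p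
  choose α β hαβ using fun j : ZMod p =>
    exists_mul_add_mul_eq_of_coprime hp hq hpq (hn.trans (Nat.le_add_right n j.val))
  refine ⟨fun z => ∑ j, z.1 ^ α j * z.2 ^ β j * H j z.2, fun z => ?_, fun t => ?_⟩
  · refine Finset.analyticAt_fun_sum _ fun j _ => ?_
    exact ((analyticAt_fst.pow _).mul (analyticAt_snd.pow _)).mul
      (((hH j).analyticAt _).comp analyticAt_snd)
  rw [hHh, Finset.mul_sum]
  refine Finset.sum_congr rfl fun j _ => ?_
  rw [← mul_assoc, ← pow_add, ← hαβ j, pow_add, pow_mul, pow_mul]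

/-- Radó-type theorem on the cusp curve `S = {z₁^p = z₂^q}` (`p, q ≥ 2`
coprime): if `f` is continuous on `S` and holomorphic relative to `S` off its
zero set, then for every `n ≥ (p−1)(q−1)` the power `f^n` is holomorphic
relative to `S` at every point of `S`. -/
theorem rado_on_cusp_curve (p q : ℕ) (hp : 2 ≤ p) (hq : 2 ≤ q)
    (hpq : Nat.Coprime p q) (f : ℂ × ℂ → ℂ)
    (hf : ContinuousOn f {z : ℂ × ℂ | z.1 ^ p = z.2 ^ q})
    (hol : ∀ x ∈ {z : ℂ × ℂ | z.1 ^ p = z.2 ^ q}, f x ≠ 0 →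
      HolomorphicRelAt {z : ℂ × ℂ | z.1 ^ p = z.2 ^ q} f x) :
    ∀ n : ℕ, (p - 1) * (q - 1) ≤ n →
      ∀ x ∈ {z : ℂ × ℂ | z.1 ^ p = z.2 ^ q},
        HolomorphicRelAt {z : ℂ × ℂ | z.1 ^ p = z.2 ^ q}
          (fun z => f z ^ n) x := by
  intro n hn x hx
  by_cases hfx : f x ≠ 0
  · obtain ⟨F, hF, V, hV, hFf⟩ := hol x hx hfx
    exact ⟨fun z => F z ^ n, hF.pow n, V, hV, fun z hz => congrArg (· ^ n) (hFf z hz)⟩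
  rw [not_not] at hfx
  have hg := differentiable_comp_normalization_of_cusp hf hol
  have hp0 : p ≠ 0 := by omega
  have hq0 : q ≠ 0 := by omega
  by_cases hx1 : x.1 = 0
  · have hx2 : x.2 = 0 := by
      have hx' : x.1 ^ p = x.2 ^ q := hx
      rw [hx1, zero_pow hp0] at hx'
      exact eq_zero_of_pow_eq_zero hx'.symm
    have hf0 : f (0 ^ q, 0 ^ p) = 0 := by
      rw [zero_pow hp0, zero_pow hq0]
      exact (congrArg f (Prod.ext hx1.symm hx2.symm)).trans hfx
    have hd : Differentiable ℂ (dslope (fun t : ℂ => f (t ^ q, t ^ p)) 0) := by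
      rw [← differentiableOn_univ] at hg ⊢
      exact (differentiableOn_dslope univ_mem).2 hg
    obtain ⟨F, hF, hFg⟩ := exists_analyticAt_comp_eq_pow_mul hp hq hpq hn (hd.pow n)
    refine ⟨F, hF x, univ, univ_mem, fun z hz => ?_⟩
    · obtain ⟨t, rfl⟩ := exists_eq_pow_pow_of_mem_cusp hp0 hq0 hpq hz.2
      have := sub_smul_dslope (fun t : ℂ => f (t ^ q, t ^ p)) 0 t
      rw [hf0, sub_zero, sub_zero, smul_eq_mul] at this
      simp only [hFg, Pi.pow_apply, ← mul_pow, this]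
  · have hx2 : x.2 ≠ 0 := fun h2 => by
      have hx' : x.1 ^ p = x.2 ^ q := hx
      rw [h2, zero_pow hq0] at hx'
      exact hx1 (eq_zero_of_pow_eq_zero hx')
    obtain ⟨a, b, -, hab⟩ := exists_zpow_mul_zpow_of_coprime hpq
    refine ⟨fun z => f ((z.1 ^ a * z.2 ^ b) ^ q, (z.1 ^ a * z.2 ^ b) ^ p) ^ n, ?_,
      {z | z.1 ≠ 0 ∧ z.2 ≠ 0}, ?_, fun z hz => ?_⟩
    · have h1 : AnalyticAt ℂ (fun z : ℂ × ℂ => z.1 ^ a * z.2 ^ b) x :=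
        (analyticAt_fst.fun_zpow hx1).mul (analyticAt_snd.fun_zpow hx2)
      exact ((hg.analyticAt _).comp_of_eq h1 rfl).pow n
    · exact (continuous_fst.continuousAt.eventually_ne hx1).and
        (continuous_snd.continuousAt.eventually_ne hx2)
    · obtain ⟨e1, e2⟩ := hab z hz.1.1 hz.1.2 hz.2
      simp only [e1, e2, Prod.mk.eta]
end

section
/- For every natural number n ≥ 1 there exist coprime integers p, q ≥ 2 and a function f : ℂ × ℂ → ℂ such that, with S = {(z₁, z₂) ∈ ℂ × ℂ : z₁^p = z₂^q}: (i) f is continuous on S; (ii) at every point x ∈ S with f(x) ≠ 0 there exists F : ℂ × ℂ → ℂ with AnalyticAt ℂ F x agreeing with f on S in a neighborhood of x (f is holomorphic relative to S off its zero set); and (iii) there is no F : ℂ × ℂ → ℂ with AnalyticAt ℂ F (0,0) agreeing with f^n on S in a neighborhood of (0, 0). In other words, no exponent n works uniformly for all such curves: the exponent n_Ω in the Radó-type extension theorem must depend on the space. -/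
/-- On the cusp curve `z₁ ^ k = z₂ ^ (k + 1)` the function `z₁ / z₂` is a `k`-th root of `z₂`. -/
theorem div_pow_eq_snd_of_mem_cusp {k : ℕ} (hk : k ≠ 0) {z : ℂ × ℂ}
    (hz : z.1 ^ k = z.2 ^ (k + 1)) : (z.1 / z.2) ^ k = z.2 := by
  by_cases h : z.2 = 0
  · simp [h, hk]
  · rw [div_pow, hz, pow_succ]
    field_simp

theorem continuousOn_div_cusp {k : ℕ} (hk : k ≠ 0) :
    ContinuousOn (fun z : ℂ × ℂ => z.1 / z.2) {z : ℂ × ℂ | z.1 ^ k = z.2 ^ (k + 1)} := by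
  intro x hx
  by_cases h : x.2 = 0
  · rw [Metric.continuousWithinAt_iff']
    intro ε hε
    have hlt : ∀ᶠ z : ℂ × ℂ in nhds x, ‖z.2‖ < ε ^ k :=
      (continuous_snd.norm.tendsto x).eventually_lt_const (by simpa [h] using pow_pos hε k)
    filter_upwards [nhdsWithin_le_nhds hlt, self_mem_nhdsWithin] with z hz hzS
    rw [h, div_zero, dist_zero_right]
    refine lt_of_pow_lt_pow_left₀ k hε.le ?_
    rwa [← norm_pow, div_pow_eq_snd_of_mem_cusp hk hzS]
  · exact (continuousAt_fst.div continuousAt_snd h).continuousWithinAt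

/-- A function analytic at the origin cannot restrict to `t ↦ t ^ n` along the
cusp parametrization `t ↦ (t ^ (n + 2), t ^ (n + 1))`. -/
theorem not_eventually_eq_pow_of_analyticAt {n : ℕ} {F : ℂ × ℂ → ℂ}
    (hF : AnalyticAt ℂ F (0, 0)) (h0 : F (0, 0) = 0) :
    ¬ ∀ᶠ t : ℂ in nhds 0, F (t ^ (n + 2), t ^ (n + 1)) = t ^ n := by
  intro h
  have hg : Filter.Tendsto (fun t : ℂ => (t ^ (n + 2), t ^ (n + 1))) (nhds 0)
      (nhds ((0, 0) : ℂ × ℂ)) := by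
    have hc : Continuous fun t : ℂ => (t ^ (n + 2), t ^ (n + 1)) := by fun_prop
    simpa using hc.tendsto 0
  have hFO := hF.differentiableAt.isBigO_sub.comp_tendsto hg
  have hgO : (fun t : ℂ => (t ^ (n + 2), t ^ (n + 1))) =O[nhds 0] fun t : ℂ => t ^ (n + 1) :=
    (Asymptotics.isLittleO_pow_pow (Nat.lt_succ_self (n + 1))).isBigO.prod_left
      (Asymptotics.isBigO_refl _ _)
  have hO : (fun t : ℂ => t ^ n) =O[nhds 0] fun t : ℂ => t ^ (n + 1) := by
    refine (hFO.trans (hgO.congr_left fun t => by simp)).congr' ?_ Filter.EventuallyEq.rfl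
    filter_upwards [h] with t ht
    simp [ht, h0]
  refine Asymptotics.isLittleO_irrefl ?_
    ((hO.trans_isLittleO (Asymptotics.isLittleO_pow_pow (Nat.lt_succ_self n))).mono
      (nhdsWithin_le_nhds (s := {0}ᶜ)))
  refine Filter.Eventually.frequently ?_
  filter_upwards [self_mem_nhdsWithin] with t ht
  exact pow_ne_zero n ht

/-- No exponent works uniformly in the Radó-type extension theorem: for every
`n ≥ 1` there are coprime `p, q ≥ 2` and a function `f` on the cusp curve
`S = {z₁^p = z₂^q}` that is continuous on `S` and holomorphic relative to `S`
off its zero set, yet `f^n` is not holomorphic relative to `S` at the cusp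
`(0, 0)`. -/
theorem exponent_depends_on_space (n : ℕ) (hn : 1 ≤ n) :
    ∃ p q : ℕ, 2 ≤ p ∧ 2 ≤ q ∧ Nat.Coprime p q ∧
      ∃ f : ℂ × ℂ → ℂ,
        ContinuousOn f {z : ℂ × ℂ | z.1 ^ p = z.2 ^ q} ∧
        (∀ x ∈ {z : ℂ × ℂ | z.1 ^ p = z.2 ^ q}, f x ≠ 0 →
          HolomorphicRelAt {z : ℂ × ℂ | z.1 ^ p = z.2 ^ q} f x) ∧
        ¬ HolomorphicRelAt {z : ℂ × ℂ | z.1 ^ p = z.2 ^ q}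
            (fun z => f z ^ n) (0, 0) := by
  refine ⟨n + 1, n + 2, by lia, by lia, Nat.coprime_self_add_right.mpr (Nat.coprime_one_right _), fun z => z.1 / z.2,
    continuousOn_div_cusp n.succ_ne_zero, ?_, ?_⟩
  · intro x _ hfx
    have h : x.2 ≠ 0 := fun h => hfx (by simp [h])
    exact ⟨_, analyticAt_fst.div analyticAt_snd h, Set.univ, Filter.univ_mem, fun _ _ => rfl⟩
  · rintro ⟨F, hF, V, hV, hFV⟩
    have hn0 : n ≠ 0 := by lia
    have h0 : F (0, 0) = 0 := by
      simpa [hn0] using hFV (0, 0) ⟨mem_of_mem_nhds hV, by simp⟩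
    have hg : Continuous fun t : ℂ => (t ^ (n + 2), t ^ (n + 1)) := by fun_prop
    refine not_eventually_eq_pow_of_analyticAt (n := n) hF h0 ?_
    filter_upwards [hg.continuousAt.preimage_mem_nhds (by simpa using hV)] with t ht
    rw [hFV _ ⟨ht, by simp only [Set.mem_ofPred_eq]; ring⟩]
    by_cases h : t = 0
    · simp [h, hn0]
    · have ht1 : t ^ (n + 2) / t ^ (n + 1) = t := by
        rw [pow_succ t (n + 1)]
        field_simp
      simp only [ht1]
end

section
/- Let p, q ≥ 2 be coprime integers and let S = {(z₁, z₂) ∈ ℂ × ℂ : z₁^p = z₂^q}. Let f : ℂ × ℂ → ℂ be continuous on S, with f(0, 0) = 0, and suppose that at every point x ∈ S with f(x) ≠ 0 there exists F : ℂ × ℂ → ℂ with AnalyticAt ℂ F x agreeing with f on S in a neighborhood of x. Then there exist constants C > 0 and ε > 0 such that for all x ∈ S with ‖x‖ ≤ ε one has ‖f(x)‖ ≤ C · ‖x‖^(1/p). -/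
open Metric Set Complex ComplexConjugate

/-- Maximum principle off the zero set of `g`: the zeros of `g` on the boundary are negligible. -/
theorem norm_le_of_forall_mem_sphere_of_ne_zero {g u : ℂ → ℂ} {M : ℝ} {c : ℂ} {R : ℝ}
    (hg : ContinuousOn g (closedBall c R))
    (hgd : ∀ z ∈ ball c R, g z ≠ 0 → DifferentiableAt ℂ g z)
    (hu : ContinuousOn u (closedBall c R))
    (hud : ∀ z ∈ ball c R, g z ≠ 0 → DifferentiableAt ℂ u z)
    (hM : 0 < M) (hb : ∀ z ∈ sphere c R, ‖u z‖ ≤ M) {a : ℂ} (ha : a ∈ ball c R)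
    (hga : g a ≠ 0) : ‖u a‖ ≤ M := by
  set U : Set ℂ := ball c R ∩ g ⁻¹' {0}ᶜ with hU
  have hUo : IsOpen U :=
    (hg.mono ball_subset_closedBall).isOpen_inter_preimage isOpen_ball isOpen_compl_singleton
  have hUc : closure U ⊆ closedBall c R :=
    closure_minimal (inter_subset_left.trans ball_subset_closedBall) isClosed_closedBall
  obtain ⟨K, hK⟩ := (isCompact_closedBall c R).exists_bound_of_continuousOn hg
  have key (n : ℕ) : ‖g a * u a ^ n‖ ≤ K * M ^ n := by
    refine Complex.norm_le_of_forall_mem_frontier_norm_le (f := fun z ↦ g z * u z ^ n) (U := U)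
      (isBounded_ball.subset inter_subset_left) ⟨?_, ?_⟩ ?_ (subset_closure ⟨ha, hga⟩)
    · exact fun z hz ↦ ((hgd z hz.1 hz.2).mul ((hud z hz.1 hz.2).pow n)).differentiableWithinAt
    · exact (hg.mul (hu.pow n)).mono hUc
    · intro z hz
      rw [hUo.frontier_eq] at hz
      have hzc := hUc hz.1
      have hK0 : 0 ≤ K := (norm_nonneg _).trans (hK z hzc)
      by_cases h0 : g z = 0
      · simp only [h0, zero_mul, norm_zero]
        positivity
      · have hzs : z ∈ sphere c R := by
          rw [← closedBall_sdiff_ball]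
          exact ⟨hzc, fun h ↦ hz.2 ⟨h, h0⟩⟩
        rw [norm_mul, norm_pow]
        gcongr
        exacts [hK z hzc, hb z hzs]
  by_contra! hlt
  have hga' : 0 < ‖g a‖ := norm_pos_iff.2 hga
  obtain ⟨n, hn⟩ := pow_unbounded_of_one_lt (K / ‖g a‖) ((one_lt_div hM).2 hlt)
  have h := key n
  rw [norm_mul, norm_pow] at h
  rw [div_pow, div_lt_div_iff₀ hga' (by positivity)] at hn
  linarith

theorem re_le_of_forall_mem_sphere_of_ne_zero {g u : ℂ → ℂ} {M : ℝ} {c : ℂ} {R : ℝ}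
    (hg : ContinuousOn g (closedBall c R))
    (hgd : ∀ z ∈ ball c R, g z ≠ 0 → DifferentiableAt ℂ g z)
    (hu : ContinuousOn u (closedBall c R))
    (hud : ∀ z ∈ ball c R, g z ≠ 0 → DifferentiableAt ℂ u z)
    (hb : ∀ z ∈ sphere c R, (u z).re ≤ M) {a : ℂ} (ha : a ∈ ball c R)
    (hga : g a ≠ 0) : (u a).re ≤ M := by
  have h := norm_le_of_forall_mem_sphere_of_ne_zero (u := fun z ↦ exp (u z)) hg hgd hu.cexp
    (fun z hz h0 ↦ (hud z hz h0).cexp) (Real.exp_pos M)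
    (fun z hz ↦ by simpa [norm_exp] using hb z hz) ha hga
  simpa [norm_exp] using h

/-- Trigonometric polynomials, viewed as real parts of entire functions, are uniformly dense
in the real continuous functions on the unit circle. -/
theorem exists_differentiable_abs_sub_re_lt {φ : ℂ → ℝ} (hφ : ContinuousOn φ (sphere 0 1))
    {ε : ℝ} (hε : 0 < ε) :
    ∃ P : ℂ → ℂ, Differentiable ℂ P ∧ ∀ z ∈ sphere (0 : ℂ) 1, |φ z - (P z).re| < ε := by
  have : Fact (0 < 2 * Real.pi) := ⟨Real.two_pi_pos⟩
  let Φ : C(AddCircle (2 * Real.pi), ℂ) :=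
    ⟨fun x ↦ (φ (AddCircle.toCircle x) : ℂ), continuous_ofReal.comp <|
      hφ.comp_continuous (continuous_subtype_val.comp AddCircle.continuous_toCircle)
        fun x ↦ (AddCircle.toCircle x).2⟩
  have hΦ : Φ ∈ (Submodule.span ℂ (range (@fourier (2 * Real.pi)))).topologicalClosure := by
    rw [span_fourier_closure_eq_top]; trivial
  obtain ⟨T, hT, hd⟩ := Metric.mem_closure_iff.1 hΦ ε hε
  have hAB : ∃ A B : ℂ → ℂ, Differentiable ℂ A ∧ Differentiable ℂ B ∧
      ∀ x, T x = A (AddCircle.toCircle x) + conj (B (AddCircle.toCircle x)) := by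
    clear hd
    induction hT using Submodule.span_induction with
    | mem T hT =>
      obtain ⟨n, rfl⟩ := hT
      obtain ⟨k, rfl | rfl⟩ := n.eq_nat_or_neg
      · exact ⟨fun z ↦ z ^ k, 0, by fun_prop, by fun_prop, fun x ↦ by
          simp [fourier_apply, AddCircle.toCircle_nsmul, -fourier_coe_apply']⟩
      · exact ⟨0, fun z ↦ z ^ k, by fun_prop, by fun_prop, fun x ↦ by
          rw [fourier_neg]
          simp [fourier_apply, AddCircle.toCircle_nsmul]⟩
    | zero => exact ⟨0, 0, by fun_prop, by fun_prop, by simp⟩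
    | add S T _ _ hS hT =>
      obtain ⟨A, B, hA, hB, h⟩ := hS
      obtain ⟨A', B', hA', hB', h'⟩ := hT
      exact ⟨A + A', B + B', hA.add hA', hB.add hB', fun x ↦ by
        simp only [ContinuousMap.add_apply, h, h', Pi.add_apply, map_add]; ring⟩
    | smul c T _ hT =>
      obtain ⟨A, B, hA, hB, h⟩ := hT
      exact ⟨fun z ↦ c * A z, fun z ↦ conj c * B z, by fun_prop, by fun_prop, fun x ↦ by
        simp only [ContinuousMap.smul_apply, h, smul_eq_mul, map_mul, conj_conj]; ring⟩
  obtain ⟨A, B, hA, hB, h⟩ := hAB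
  refine ⟨A + B, hA.add hB, fun z hz ↦ ?_⟩
  obtain ⟨x, hxz⟩ : ∃ x : AddCircle (2 * Real.pi), (AddCircle.toCircle x : ℂ) = z := by
    refine ⟨(arg z : ℝ), ?_⟩
    have hz1 : ‖z‖ = 1 := by simpa using hz
    rw [AddCircle.toCircle_apply_mk, div_self Real.two_pi_pos.ne', one_mul, Circle.coe_exp]
    simpa [hz1] using norm_mul_exp_arg_mul_I z
  have h1 := (ContinuousMap.dist_apply_le_dist x).trans_lt hd
  rw [dist_eq, h, hxz] at h1
  have h2 := (abs_re_le_norm _).trans_lt h1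
  simpa [Φ, hxz] using h2


theorem re_le_circleAverage_poissonKernel {g u : ℂ → ℂ}
    (hg : ContinuousOn g (closedBall 0 1))
    (hgd : ∀ z ∈ ball 0 1, g z ≠ 0 → DifferentiableAt ℂ g z)
    (hu : ContinuousOn u (closedBall 0 1))
    (hud : ∀ z ∈ ball 0 1, g z ≠ 0 → DifferentiableAt ℂ u z)
    {a : ℂ} (ha : a ∈ ball (0 : ℂ) 1) (hga : g a ≠ 0) :
    (u a).re ≤ Real.circleAverage (fun z ↦ poissonKernel 0 a z * (u z).re) 0 1 := by
  have hus : ContinuousOn (fun z ↦ (u z).re) (sphere 0 1) :=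
    (continuous_re.comp_continuousOn hu).mono sphere_subset_closedBall
  have hker : ContinuousOn (poissonKernel 0 a) (sphere 0 1) := by
    rw [poissonKernel_eq_re_herglotzRieszKernel]
    simpa using continuous_re.comp_continuousOn (continuousOn_herglotzRieszKernel_sphere ha)
  have hker0 (z : ℂ) (hz : z ∈ sphere (0 : ℂ) 1) : 0 ≤ poissonKernel 0 a z := by
    have ha' : ‖a‖ < 1 := by simpa using ha
    have hz' : ‖z‖ = 1 := by simpa using hz
    rw [poissonKernel_def, sub_zero, sub_zero, hz']
    have : ‖a‖ ^ 2 ≤ 1 := by nlinarith [norm_nonneg a]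
    apply div_nonneg <;> nlinarith [sq_nonneg ‖z - a‖]
  have hpois {P : ℂ → ℂ} (hP : Differentiable ℂ P) :
      (P a).re = Real.circleAverage (fun z ↦ poissonKernel 0 a z * (P z).re) 0 1 := by
    rw [← hP.diffContOnCl.circleAverage_poissonKernel_smul ha, ← reCLM_apply,
      ← reCLM.circleAverage_comp_comm]
    · simp [Function.comp_def]
    · exact ContinuousOn.circleIntegrable zero_le_one (hker.smul hP.continuous.continuousOn)
  refine le_of_forall_pos_le_add fun ε hε ↦ ?_
  have hshift (w : ℂ) : (w - ε / 2).re = w.re - ε / 2 := by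
    rw [sub_re, show (ε / 2 : ℂ) = ((ε / 2 : ℝ) : ℂ) by push_cast; rfl, ofReal_re]
  obtain ⟨P, hP, hPu⟩ := exists_differentiable_abs_sub_re_lt hus (half_pos hε)
  have h1 : ((u - P) a).re ≤ ε / 2 :=
    re_le_of_forall_mem_sphere_of_ne_zero hg hgd (hu.sub hP.continuous.continuousOn)
      (fun z hz h0 ↦ (hud z hz h0).sub (hP z))
      (fun z hz ↦ by simpa using (abs_lt.1 (hPu z hz)).2.le) ha hga
  have h2 : ((fun z ↦ P z - ε / 2) a).re ≤
      Real.circleAverage (fun z ↦ poissonKernel 0 a z * (u z).re) 0 1 := by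
    rw [hpois (hP.sub_const _)]
    refine Real.circleAverage_mono ?_ ?_ fun z hz ↦ ?_
    · refine ContinuousOn.circleIntegrable zero_le_one (hker.mul ?_)
      have := hP.continuous
      fun_prop
    · exact ContinuousOn.circleIntegrable zero_le_one (hker.mul hus)
    · rw [abs_one] at hz
      refine mul_le_mul_of_nonneg_left ?_ (hker0 z hz)
      have := (abs_lt.1 (hPu z hz)).1
      linarith [hshift (P z)]
  simp only [hshift, Pi.sub_apply, sub_re] at h1 h2
  linarith

/-- A continuous function on the closed disc that is holomorphic off the zeros of `g` has, off
these zeros, the same real part as some function holomorphic on the whole disc. -/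
theorem exists_differentiableOn_re_eq {g u : ℂ → ℂ}
    (hg : ContinuousOn g (closedBall 0 1))
    (hgd : ∀ z ∈ ball 0 1, g z ≠ 0 → DifferentiableAt ℂ g z)
    (hu : ContinuousOn u (closedBall 0 1))
    (hud : ∀ z ∈ ball 0 1, g z ≠ 0 → DifferentiableAt ℂ u z) :
    ∃ H : ℂ → ℂ, DifferentiableOn ℂ H (ball 0 1) ∧
      ∀ z ∈ ball 0 1, g z ≠ 0 → (H z).re = (u z).re := by
  have hint : CircleIntegrable (fun z ↦ (u z).re) 0 1 :=
    ContinuousOn.circleIntegrable zero_le_one <|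
      (continuous_re.comp_continuousOn hu).mono sphere_subset_closedBall
  have hintC : CircleIntegrable (fun z ↦ ((u z).re : ℂ)) 0 1 :=
    ContinuousOn.circleIntegrable zero_le_one <| (continuous_ofReal.comp_continuousOn <|
      continuous_re.comp_continuousOn hu).mono sphere_subset_closedBall
  refine ⟨_, differentiableOn_circleAverage_herglotzRieszKernel_smul hintC, fun a ha hga ↦ ?_⟩
  rw [re_circleAverage_herglotzRieszKernel_smul hint ha, ← poissonKernel_eq_re_herglotzRieszKernel]
  refine le_antisymm ?_ (re_le_circleAverage_poissonKernel hg hgd hu hud ha hga)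
  have h := re_le_circleAverage_poissonKernel hg hgd hu.neg
    (fun z hz h0 ↦ (hud z hz h0).neg) ha hga
  have h' : Real.circleAverage (fun z ↦ poissonKernel 0 a z * (-u z).re) 0 1 =
      -Real.circleAverage (poissonKernel 0 a • fun z ↦ (u z).re) 0 1 := by
    rw [← neg_one_smul ℝ, ← Real.circleAverage_smul]
    congr 1
    ext z
    simp
  simp only [Pi.neg_apply, neg_re] at h h'
  linarith

theorem deriv_eq_of_eventually_re_eq {f h : ℂ → ℂ} {a : ℂ} (hf : DifferentiableAt ℂ f a)
    (hh : DifferentiableAt ℂ h a) (he : ∀ᶠ z in nhds a, (f z).re = (h z).re) :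
    deriv f a = deriv h a := by
  have hF := reCLM.hasFDerivAt.comp a (hf.hasDerivAt.hasFDerivAt.restrictScalars ℝ)
  have hH := reCLM.hasFDerivAt.comp a (hh.hasDerivAt.hasFDerivAt.restrictScalars ℝ)
  have := hF.unique (hH.congr_of_eventuallyEq he)
  have h1 := DFunLike.congr_fun this 1
  have h2 := DFunLike.congr_fun this I
  simp at h1 h2
  exact Complex.ext h1 h2

/-- **Radó's theorem** on the unit disc: a continuous function that is holomorphic off its zero
set either vanishes identically or coincides, off its zeros, with a holomorphic function. -/
theorem exists_differentiableOn_eq_of_ne_zero {g : ℂ → ℂ}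
    (hg : ContinuousOn g (closedBall 0 1))
    (hgd : ∀ z ∈ ball 0 1, g z ≠ 0 → DifferentiableAt ℂ g z) :
    ∃ G : ℂ → ℂ, DifferentiableOn ℂ G (ball 0 1) ∧ ∀ z ∈ ball 0 1, g z ≠ 0 → G z = g z := by
  by_cases hne : ∀ z ∈ ball (0 : ℂ) 1, g z = 0
  · exact ⟨0, differentiableOn_const 0, fun z hz h ↦ absurd (hne z hz) h⟩
  push Not at hne
  obtain ⟨a, ha, hga⟩ := hne
  obtain ⟨H₁, hd₁, hr₁⟩ := exists_differentiableOn_re_eq hg hgd hg hgd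
  obtain ⟨H₂, hd₂, hr₂⟩ := exists_differentiableOn_re_eq hg hgd
    (u := fun z ↦ -I * g z) (hg.const_mul _) (fun z hz h0 ↦ (hgd z hz h0).const_mul _)
  have hopen : IsOpen (ball (0 : ℂ) 1 ∩ g ⁻¹' {0}ᶜ) :=
    (hg.mono ball_subset_closedBall).isOpen_inter_preimage isOpen_ball isOpen_compl_singleton
  have hd : DifferentiableOn ℂ (fun z ↦ H₁ z - I * H₂ z) (ball 0 1) :=
    hd₁.sub (hd₂.const_mul I)
  have hderiv : ∀ᶠ z in nhds a, deriv (fun z ↦ H₁ z - I * H₂ z) z = 0 := by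
    filter_upwards [hopen.mem_nhds ⟨ha, hga⟩] with z hz
    have hn := hopen.mem_nhds hz
    have hz₁ := hd₁.differentiableAt (isOpen_ball.mem_nhds hz.1)
    have hz₂ := hd₂.differentiableAt (isOpen_ball.mem_nhds hz.1)
    have hgz := hgd z hz.1 hz.2
    have e₁ := deriv_eq_of_eventually_re_eq hz₁ hgz <| by
      filter_upwards [hn] with w hw using hr₁ w hw.1 hw.2
    have e₂ := deriv_eq_of_eventually_re_eq hz₂ (hgz.const_mul (-I)) <| by
      filter_upwards [hn] with w hw using hr₂ w hw.1 hw.2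
    rw [deriv_const_mul _ hgz] at e₂
    rw [deriv_fun_sub hz₁ (hz₂.const_mul I), deriv_const_mul _ hz₂, e₁, e₂]
    linear_combination deriv g z * I_mul_I
  have hconn : IsPreconnected (ball (0 : ℂ) 1) := (convex_ball 0 1).isPreconnected
  have hzero : EqOn (deriv fun z ↦ H₁ z - I * H₂ z) 0 (ball 0 1) :=
    ((hd.deriv isOpen_ball).analyticOnNhd isOpen_ball).eqOn_zero_of_preconnected_of_eventuallyEq_zero
      hconn ha hderiv
  obtain ⟨c, hc⟩ := isOpen_ball.exists_is_const_of_deriv_eq_zero hconn hd hzero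
  refine ⟨fun z ↦ H₁ z - I * c.im, hd₁.sub_const _, fun z hz h0 ↦ ?_⟩
  have h₁ := hr₁ z hz h0
  have h₂ := hr₂ z hz h0
  have h₃ := congrArg im (hc z hz)
  simp at h₂ h₃
  apply Complex.ext <;> simp
  · exact h₁
  · linarith

/-- A continuous function, holomorphic off its zero set, that vanishes at the origin is
`O(‖t‖)` there. -/
theorem exists_norm_le_mul_norm_of_eq_zero {g : ℂ → ℂ} (hg : Continuous g)
    (hgd : ∀ z, g z ≠ 0 → DifferentiableAt ℂ g z) (h0 : g 0 = 0) :
    ∃ C > 0, ∃ r > 0, ∀ t, ‖t‖ ≤ r → ‖g t‖ ≤ C * ‖t‖ := by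
  obtain ⟨G, hG, hGg⟩ := exists_differentiableOn_eq_of_ne_zero hg.continuousOn
    fun z _ ↦ hgd z
  have hG0 : DifferentiableAt ℂ G 0 := hG.differentiableAt (ball_mem_nhds 0 one_pos)
  have hbound : ∃ C > 0, ∀ᶠ t in nhds (0 : ℂ), ‖g t‖ ≤ C * ‖t‖ := by
    by_cases hG00 : G 0 = 0
    · obtain ⟨C, hC, h⟩ := hG0.isBigO_sub.exists_pos
      refine ⟨C, hC, ?_⟩
      filter_upwards [h.bound, ball_mem_nhds (0 : ℂ) one_pos] with t ht htb
      by_cases hgt : g t = 0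
      · rw [hgt, norm_zero]
        positivity
      · simpa [hGg t htb hgt, hG00] using ht
    · refine ⟨1, one_pos, ?_⟩
      have hne : ∀ᶠ t in nhds (0 : ℂ), G t - g t ≠ 0 :=
        (hG0.continuousAt.sub hg.continuousAt).eventually_ne (by simpa [h0] using hG00)
      filter_upwards [hne, ball_mem_nhds (0 : ℂ) one_pos] with t ht htb
      have hgt : g t = 0 := by
        by_contra hgt
        exact ht (sub_eq_zero.2 (hGg t htb hgt))
      simp [hgt]
  obtain ⟨C, hC, h⟩ := hbound
  obtain ⟨r, hr, hs⟩ := Metric.nhds_basis_closedBall.eventually_iff.1 h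
  exact ⟨C, hC, r, hr, fun t ht ↦ hs (by simpa using ht)⟩

/-- The normalization `t ↦ (t ^ q, t ^ p)` is onto the cusp curve. -/
theorem exists_pow_eq_of_pow_eq_pow {K : Type*} [Field K] {p q : ℕ} (hp : p ≠ 0) (hq : q ≠ 0)
    (hpq : p.Coprime q) {x y : K} (h : x ^ p = y ^ q) : ∃ t : K, t ^ q = x ∧ t ^ p = y := by
  rcases eq_or_ne x 0 with rfl | hx
  · have hy : y = 0 := by
      rw [zero_pow hp] at h
      exact pow_eq_zero_iff hq |>.1 h.symm
    exact ⟨0, by simp [hp, hq, hy]⟩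
  have hy : y ≠ 0 := by
    rintro rfl
    rw [zero_pow hq] at h
    exact hx (pow_eq_zero_iff hp |>.1 h)
  have hbez : (p : ℤ) * p.gcdA q + q * p.gcdB q = 1 := by
    rw [← Nat.gcd_eq_gcd_ab, hpq.gcd_eq_one, Nat.cast_one]
  have hz : x ^ (p : ℤ) = y ^ (q : ℤ) := by exact_mod_cast h
  refine ⟨x ^ p.gcdB q * y ^ p.gcdA q, ?_, ?_⟩
  · calc (x ^ p.gcdB q * y ^ p.gcdA q) ^ q
        = x ^ (q * p.gcdB q) * (y ^ (q : ℤ)) ^ p.gcdA q := by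
          rw [mul_pow, ← zpow_natCast, ← zpow_natCast, ← zpow_mul, ← zpow_mul, ← zpow_mul,
            mul_comm (p.gcdB q), mul_comm (p.gcdA q)]
      _ = x := by
          rw [← hz, ← zpow_mul, ← zpow_add₀ hx, add_comm, hbez, zpow_one]
  · calc (x ^ p.gcdB q * y ^ p.gcdA q) ^ p
        = (x ^ (p : ℤ)) ^ p.gcdB q * y ^ (p * p.gcdA q) := by
          rw [mul_pow, ← zpow_natCast, ← zpow_natCast, ← zpow_mul, ← zpow_mul, ← zpow_mul,
            mul_comm (p.gcdB q), mul_comm (p.gcdA q)]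
      _ = y := by
          rw [hz, ← zpow_mul, ← zpow_add₀ hy, add_comm, hbez, zpow_one]


/-- Order-of-flatness estimate on the cusp curve `S = {z₁^p = z₂^q}`
(`p, q ≥ 2` coprime): a function continuous on `S`, vanishing at the cusp and
holomorphic relative to `S` off its zero set satisfies
`‖f(x)‖ ≤ C·‖x‖^(1/p)` near the cusp. -/
theorem order_of_flatness (p q : ℕ) (hp : 2 ≤ p) (hq : 2 ≤ q)
    (hpq : Nat.Coprime p q) (f : ℂ × ℂ → ℂ)
    (hf : ContinuousOn f {z : ℂ × ℂ | z.1 ^ p = z.2 ^ q})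
    (hf0 : f (0, 0) = 0)
    (hol : ∀ x ∈ {z : ℂ × ℂ | z.1 ^ p = z.2 ^ q}, f x ≠ 0 →
      ∃ F : ℂ × ℂ → ℂ, AnalyticAt ℂ F x ∧
        ∃ V ∈ nhds x, ∀ z ∈ V ∩ {z : ℂ × ℂ | z.1 ^ p = z.2 ^ q}, F z = f z) :
    ∃ C > (0 : ℝ), ∃ ε > (0 : ℝ),
      ∀ x ∈ {z : ℂ × ℂ | z.1 ^ p = z.2 ^ q}, ‖x‖ ≤ ε →
        ‖f x‖ ≤ C * ‖x‖ ^ ((1 : ℝ) / p) := by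
  have hmem (t : ℂ) : (t ^ q, t ^ p) ∈ {z : ℂ × ℂ | z.1 ^ p = z.2 ^ q} := by
    simp only [mem_ofPred_eq, ← pow_mul, mul_comm]
  have hπ : Continuous fun t : ℂ ↦ (t ^ q, t ^ p) := by fun_prop
  obtain ⟨C, hC, r, hr, hbound⟩ := exists_norm_le_mul_norm_of_eq_zero
    (g := fun t ↦ f (t ^ q, t ^ p)) (hf.comp_continuous hπ hmem)
    (fun t ht ↦ by
      obtain ⟨F, hF, V, hV, hFV⟩ := hol _ (hmem t) ht
      have hFπ : DifferentiableAt ℂ (fun t : ℂ ↦ F (t ^ q, t ^ p)) t :=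
        hF.differentiableAt.comp t (f := fun t : ℂ ↦ (t ^ q, t ^ p)) (by fun_prop)
      refine hFπ.congr_of_eventuallyEq ?_
      filter_upwards [hπ.continuousAt hV] with s hs using (hFV _ ⟨hs, hmem s⟩).symm)
    (by simpa [show p ≠ 0 by omega, show q ≠ 0 by omega] using hf0)
  refine ⟨C, hC, r ^ p, pow_pos hr p, ?_⟩
  rintro ⟨x, y⟩ hxy hle
  obtain ⟨t, rfl, rfl⟩ := exists_pow_eq_of_pow_eq_pow (by omega) (by omega) hpq hxy
  have hy : ‖t‖ ^ p ≤ ‖(t ^ q, t ^ p)‖ := by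
    rw [← norm_pow]
    exact norm_snd_le (t ^ q, t ^ p)
  have htr : ‖t‖ ≤ r := le_of_pow_le_pow_left₀ (by omega) hr.le (hy.trans hle)
  refine (hbound t htr).trans ?_
  gcongr
  calc ‖t‖ = (‖t‖ ^ p) ^ ((1 : ℝ) / p) := by
        rw [one_div, Real.pow_rpow_inv_natCast (norm_nonneg t) (by omega)]
    _ ≤ ‖(t ^ q, t ^ p)‖ ^ ((1 : ℝ) / p) := by gcongr
end
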